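/- arXiv:1709.00858 — 8 statements merged into one kernel-verified Lean document; each statement's English description precedes it below -/
import Mathlib

section
/- For every finite alphabet Σ with at least two elements, the group Aut(Σ^ℤ) of reversible cellular automata does not satisfy the Tits alternative: Aut(Σ^ℤ) has a finitely generated subgroup which is not virtually solvable and which contains no subgroup isomorphic to the free group on two generators. -/
def shiftMapZ (A : Type*) : (ℤ → A) → (ℤ → A) := fun x i => x (i + 1)

def CommCont {X : Type*} [TopologicalSpace X] (S : Set (X → X)) (f : Equiv.Perm X) : Prop :=
  Continuous ⇑f ∧ ∀ s ∈ S, ∀ x, f (s x) = s (f x)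

theorem CommCont.mul {X : Type*} [TopologicalSpace X] {S : Set (X → X)}
    {f g : Equiv.Perm X} (hf : CommCont S f) (hg : CommCont S g) : CommCont S (f * g) := by
  refine ⟨by simpa [Equiv.Perm.coe_mul] using hf.1.comp hg.1, fun s hs x => ?_⟩
  rw [Equiv.Perm.mul_apply, hg.2 s hs, hf.2 s hs, ← Equiv.Perm.mul_apply]

theorem CommCont.one {X : Type*} [TopologicalSpace X] {S : Set (X → X)} :
    CommCont S (1 : Equiv.Perm X) :=
  ⟨by simpa [Equiv.Perm.coe_one] using continuous_id, fun _ _ _ => rfl⟩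

/-- The automorphism group: continuous bijections (with continuous inverse) commuting with
every map in `S`. -/
def CAut {X : Type*} [TopologicalSpace X] (S : Set (X → X)) : Subgroup (Equiv.Perm X) where
  carrier := {f | CommCont S f ∧ CommCont S f⁻¹}
  one_mem' := ⟨CommCont.one, by rw [inv_one]; exact CommCont.one⟩
  mul_mem' := fun hf hg => ⟨hf.1.mul hg.1, by rw [mul_inv_rev]; exact hg.2.mul hf.2⟩
  inv_mem' := fun hf => ⟨hf.2, by rw [inv_inv]; exact hf.1⟩

namespace Tits

abbrev C := Bool × Bool
abbrev Q := Fin 5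
abbrev Y := ℤ → Option C

section enc
variable {Γ : Type} (o z : Γ)

def bit (d : C × Q) (r : ℤ) : Bool :=
  if r = 3 then d.1.1 else if r = 5 then d.1.2 else decide (r = 7 + 2 * (d.2.val : ℤ))

open Classical in
/-- The code word (of length 17) of a data symbol. -/
noncomputable def enc (d : C × Q) (r : ℤ) : Γ :=
  if r = 0 ∨ r = 1 then o else if r % 2 = 0 then z else if bit d r = true then o else z

def Occ (x : ℤ → Γ) (i : ℤ) (d : C × Q) : Prop :=
  ∀ r : ℤ, 0 ≤ r → r < 17 → x (i + r) = enc o z d r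

variable {o z}

theorem bit_inj {d d' : C × Q} (h : ∀ r : ℤ, 0 ≤ r → r < 17 → r % 2 = 1 → 3 ≤ r → bit d r = bit d' r) :
    d = d' := by
  obtain ⟨⟨t, b⟩, q⟩ := d
  obtain ⟨⟨t', b'⟩, q'⟩ := d'
  have h3 := h 3 (by norm_num) (by norm_num) (by norm_num) (by norm_num)
  have h5 := h 5 (by norm_num) (by norm_num) (by norm_num) (by norm_num)
  have hq := h (7 + 2 * (q.val : ℤ)) (by omega) (by omega) (by omega) (by omega)
  simp only [bit] at h3 h5 hq
  rw [if_neg (by omega), if_neg (by omega), if_neg (by omega), if_neg (by omega)] at hq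
  have : q = q' := by
    have := of_decide_eq_true (hq.symm.trans (by simp))
    apply Fin.ext
    omega
  simp at h3 h5
  simp [h3, h5, this]

theorem enc_inj (hoz : o ≠ z) {d d' : C × Q}
    (h : ∀ r : ℤ, 0 ≤ r → r < 17 → enc o z d r = enc o z d' r) : d = d' := by
  apply bit_inj
  intro r h0 h1 h2 h3
  have := h r h0 h1
  have n1 : ¬ (r = 0 ∨ r = 1) := by omega
  have n2 : ¬ (r % 2 = 0) := by omega
  simp only [enc, if_neg n1, if_neg n2] at this
  cases hb : bit d r <;> cases hb' : bit d' r <;> simp only [hb, hb'] at this ⊢ <;> simp at this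
  · exact absurd this.symm hoz
  · exact absurd this hoz

theorem occ_unique (hoz : o ≠ z) {x : ℤ → Γ} {i : ℤ} {d d' : C × Q} (h : Occ o z x i d)
    (h' : Occ o z x i d') : d = d' :=
  enc_inj hoz fun r h0 h1 => (h r h0 h1).symm.trans (h' r h0 h1)

theorem occ_overlap (hoz : o ≠ z) {x : ℤ → Γ} {i i' : ℤ} {d d' : C × Q} (h : Occ o z x i d)
    (h' : Occ o z x i' d') (h1 : i < i') (h2 : i' < i + 17) : False := by
  have e0 := h' 0 (by omega) (by omega)
  have e1 := h' 1 (by omega) (by omega)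
  rcases Int.emod_two_eq_zero_or_one (i' - i) with hp | hp
  · have e2 := h (i' - i) (by omega) (by omega)
    rw [show i + (i' - i) = i' + 0 by ring, e0] at e2
    unfold enc at e2
    rw [if_pos (by omega), if_neg (by omega), if_pos hp] at e2
    exact hoz e2
  · have e2 := h (i' - i + 1) (by omega) (by omega)
    rw [show i + (i' - i + 1) = i' + 1 by ring, e1] at e2
    unfold enc at e2
    rw [if_pos (by omega), if_neg (by omega), if_pos (by omega)] at e2
    exact hoz e2

variable (o z)

open Classical in
noncomputable def dec (x : ℤ → Γ) (i : ℤ) : Option (C × Q) :=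
  if h : ∃ d, Occ o z x i d then some h.choose else none

variable {o z}

theorem dec_some (hoz : o ≠ z) {x : ℤ → Γ} {i : ℤ} {d : C × Q} :
    dec o z x i = some d ↔ Occ o z x i d := by
  unfold dec
  split_ifs with h
  · constructor
    · intro e
      have := h.choose_spec
      simp at e
      rwa [e] at this
    · intro e
      rw [occ_unique hoz h.choose_spec e]
  · simp
    exact fun e => h ⟨d, e⟩

variable (o z)

noncomputable def dC (x : ℤ → Γ) : Y := fun i => (dec o z x i).map Prod.fst
noncomputable def dQ (x : ℤ → Γ) (i : ℤ) : Option Q := (dec o z x i).map Prod.snd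

/-- Position `j` is covered by a code word. -/
def Cov (x : ℤ → Γ) (j : ℤ) : Prop := ∃ i d, Occ o z x i d ∧ i ≤ j ∧ j < i + 17

noncomputable def newd (φ : Y → Y) (ρ : Y → ℤ → Equiv.Perm Q) (x : ℤ → Γ) (i : ℤ) : C × Q :=
  ((φ (dC o z x) i).getD default, ρ (dC o z x) i ((dQ o z x i).getD 0))

open Classical in
noncomputable def T (φ : Y → Y) (ρ : Y → ℤ → Equiv.Perm Q) (x : ℤ → Γ) (j : ℤ) : Γ :=
  if h : Cov o z x j then enc o z (newd o z φ ρ x h.choose) (j - h.choose) else x j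

structure Rel (φ : Y → Y) (ρ : Y → ℤ → Equiv.Perm Q) (h : (ℤ → Γ) → (ℤ → Γ)) : Prop where
  c : ∀ x, dC o z (h x) = φ (dC o z x)
  q : ∀ x i, dQ o z (h x) i = (dQ o z x i).map (ρ (dC o z x) i)
  u : ∀ x j, ¬ Cov o z x j → h x j = x j

variable {o z}

theorem occ_eq (hoz : o ≠ z) {x : ℤ → Γ} {i i' j : ℤ} {d d' : C × Q} (h : Occ o z x i d)
    (h' : Occ o z x i' d') (h1 : i ≤ j) (h2 : j < i + 17) (h3 : i' ≤ j) (h4 : j < i' + 17) :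
    i = i' := by
  rcases lt_trichotomy i i' with l | l | l
  · exact (occ_overlap hoz h h' l (by omega)).elim
  · exact l
  · exact (occ_overlap hoz h' h l (by omega)).elim

theorem T_cov (hoz : o ≠ z) {φ : Y → Y} {ρ : Y → ℤ → Equiv.Perm Q} {x : ℤ → Γ} {i j : ℤ}
    {d : C × Q} (h : Occ o z x i d) (h1 : i ≤ j) (h2 : j < i + 17) :
    T o z φ ρ x j = enc o z (newd o z φ ρ x i) (j - i) := by
  have hc : Cov o z x j := ⟨i, d, h, h1, h2⟩
  unfold T
  rw [dif_pos hc]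
  obtain ⟨d', h', h3, h4⟩ := hc.choose_spec
  rw [occ_eq hoz h' h h3 h4 h1 h2]

theorem T_uncov {φ : Y → Y} {ρ : Y → ℤ → Equiv.Perm Q} {x : ℤ → Γ} {j : ℤ}
    (h : ¬ Cov o z x j) : T o z φ ρ x j = x j := by
  unfold T
  rw [dif_neg h]

theorem T_occ (hoz : o ≠ z) {φ : Y → Y} {ρ : Y → ℤ → Equiv.Perm Q} {x : ℤ → Γ} {i : ℤ}
    {d : C × Q} (h : Occ o z x i d) : Occ o z (T o z φ ρ x) i (newd o z φ ρ x i) := by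
  intro r h0 h1
  rw [T_cov hoz h (by omega) (by omega)]
  congr 1
  ring

theorem T_occ_rev (hoz : o ≠ z) {φ : Y → Y} {ρ : Y → ℤ → Equiv.Perm Q} {x : ℤ → Γ} {i : ℤ}
    {e : C × Q} (h : Occ o z (T o z φ ρ x) i e) : ∃ d, Occ o z x i d := by
  by_contra hn
  by_cases hc : ∃ r : ℤ, 0 ≤ r ∧ r < 17 ∧ Cov o z x (i + r)
  · obtain ⟨r, h0, h1, i', d', h', h2, h3⟩ := hc
    have := occ_eq hoz (T_occ hoz (φ := φ) (ρ := ρ) h') h h2 h3 (by omega) (by omega)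
    subst this
    exact hn ⟨d', h'⟩
  · apply hn
    refine ⟨e, fun r h0 h1 => ?_⟩
    rw [← h r h0 h1, T_uncov fun hh => hc ⟨r, h0, h1, hh⟩]

theorem T_rel (hoz : o ≠ z) {φ : Y → Y} {ρ : Y → ℤ → Equiv.Perm Q}
    (hφ : ∀ y i, (φ y i).isSome = (y i).isSome) : Rel o z φ ρ (T o z φ ρ) := by
  have key : ∀ x i, (∃ d, Occ o z x i d ∧ dec o z x i = some d ∧
      dec o z (T o z φ ρ x) i = some (newd o z φ ρ x i)) ∨
      (dec o z x i = none ∧ dec o z (T o z φ ρ x) i = none) := by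
    intro x i
    by_cases h : ∃ d, Occ o z x i d
    · obtain ⟨d, h⟩ := h
      exact Or.inl ⟨d, h, (dec_some hoz).2 h, (dec_some hoz).2 (T_occ hoz h)⟩
    · right
      constructor
      · unfold dec
        rw [dif_neg h]
      · unfold dec
        rw [dif_neg]
        rintro ⟨e, he⟩
        exact h (T_occ_rev hoz he)
  refine ⟨fun x => ?_, fun x i => ?_, fun x j => T_uncov⟩
  · funext i
    have := hφ (dC o z x) i
    rcases key x i with ⟨d, _, h1, h2⟩ | ⟨h1, h2⟩
    · simp only [dC, h1, h2, newd] at *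
      simp at this
      obtain ⟨a, ha⟩ := Option.isSome_iff_exists.1 this
      simp [ha]
    · simp only [dC, h1, h2] at *
      simp at this
      simp [this]
  · rcases key x i with ⟨d, _, h1, h2⟩ | ⟨h1, h2⟩
    · simp [dQ, h1, h2, newd]
    · simp [dQ, h1, h2]

theorem dec_ext {x x' : ℤ → Γ} {i : ℤ} (hc : dC o z x = dC o z x') (hq : dQ o z x i = dQ o z x' i) :
    dec o z x i = dec o z x' i := by
  have hc := congrFun hc i
  simp only [dC, dQ] at hc hq
  rcases h : dec o z x i with _ | ⟨c, q⟩ <;> rcases h' : dec o z x' i with _ | ⟨c', q'⟩ <;>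
    simp_all

theorem x_ext (hoz : o ≠ z) {x x' : ℤ → Γ} (hc : dC o z x = dC o z x')
    (hq : ∀ i, dQ o z x i = dQ o z x' i) (hu : ∀ j, ¬ Cov o z x j → x j = x' j) : x = x' := by
  funext j
  by_cases h : Cov o z x j
  · obtain ⟨i, d, h, h1, h2⟩ := h
    have h' : Occ o z x' i d := by
      rw [← dec_some hoz, ← dec_ext hc (hq i), dec_some hoz]
      exact h
    have e := h (j - i) (by omega) (by omega)
    have e' := h' (j - i) (by omega) (by omega)
    rw [show i + (j - i) = j by ring] at e e'
    rw [e, e']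
  · exact hu j h

theorem cov_iff (hoz : o ≠ z) {x : ℤ → Γ} {j : ℤ} :
    Cov o z x j ↔ ∃ i, (dQ o z x i).isSome ∧ i ≤ j ∧ j < i + 17 := by
  constructor
  · rintro ⟨i, d, h, h1⟩
    refine ⟨i, ?_, h1⟩
    simp [dQ, (dec_some hoz).2 h]
  · rintro ⟨i, h, h1⟩
    simp only [dQ, Option.isSome_map] at h
    obtain ⟨d, hd⟩ := Option.isSome_iff_exists.1 h
    exact ⟨i, d, (dec_some hoz).1 hd, h1⟩

theorem Rel.cov (hoz : o ≠ z) {φ : Y → Y} {ρ : Y → ℤ → Equiv.Perm Q} {h : (ℤ → Γ) → (ℤ → Γ)}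
    (H : Rel o z φ ρ h) (x : ℤ → Γ) (j : ℤ) : Cov o z (h x) j ↔ Cov o z x j := by
  rw [cov_iff hoz, cov_iff hoz]
  simp [H.q]

theorem Rel.id : Rel o z id (fun _ _ => 1) (fun x : ℤ → Γ => x) :=
  ⟨fun _ => rfl, fun x i => by simp, fun _ _ _ => rfl⟩

theorem Rel.comp (hoz : o ≠ z) {φ φ' : Y → Y} {ρ ρ' : Y → ℤ → Equiv.Perm Q}
    {h h' : (ℤ → Γ) → (ℤ → Γ)} (H : Rel o z φ ρ h) (H' : Rel o z φ' ρ' h') :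
    Rel o z (fun y => φ (φ' y)) (fun y i => ρ (φ' y) i * ρ' y i) (fun x => h (h' x)) := by
  refine ⟨fun x => ?_, fun x i => ?_, fun x j hj => ?_⟩
  · rw [H.c, H'.c]
  · rw [H.q, H'.c, H'.q, Option.map_map]
    rfl
  · rw [H.u _ _ (by rwa [H'.cov hoz]), H'.u _ _ hj]

theorem Rel.unique (hoz : o ≠ z) {φ : Y → Y} {ρ : Y → ℤ → Equiv.Perm Q}
    {h h' : (ℤ → Γ) → (ℤ → Γ)} (H : Rel o z φ ρ h) (H' : Rel o z φ ρ h') : h = h' := by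
  funext x
  refine x_ext hoz (by rw [H.c, H'.c]) (fun i => by rw [H.q, H'.q]) fun j hj => ?_
  rw [H.cov hoz] at hj
  rw [H.u _ _ hj, H'.u _ _ hj]


theorem dec_congr (hoz : o ≠ z) {x x' : ℤ → Γ} {i i' : ℤ}
    (h : ∀ r : ℤ, 0 ≤ r → r < 17 → x (i + r) = x' (i' + r)) : dec o z x i = dec o z x' i' := by
  ext d
  rw [dec_some hoz, dec_some hoz]
  exact ⟨fun H r h0 h1 => (h r h0 h1).symm.trans (H r h0 h1),
    fun H r h0 h1 => (h r h0 h1).trans (H r h0 h1)⟩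

structure Nice (φ : Y → Y) (ρ : Y → ℤ → Equiv.Perm Q) : Prop where
  supp : ∀ y i, (φ y i).isSome = (y i).isSome
  eqφ : ∀ y i, φ (fun i => y (i + 1)) i = φ y (i + 1)
  eqρ : ∀ y i, ρ (fun i => y (i + 1)) i = ρ y (i + 1)
  locφ : ∀ y y' i, (∀ j, i - 17 ≤ j → j ≤ i + 17 → y j = y' j) → φ y i = φ y' i
  locρ : ∀ y y' i, (∀ j, i - 17 ≤ j → j ≤ i + 17 → y j = y' j) → ρ y i = ρ y' i

theorem T_congr (hoz : o ≠ z) {φ : Y → Y} {ρ : Y → ℤ → Equiv.Perm Q} {x x' : ℤ → Γ} {j j' : ℤ}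
    (hx : x j = x' j')
    (hd : ∀ r : ℤ, -17 ≤ r → r ≤ 17 → dec o z x (j + r) = dec o z x' (j' + r))
    (hn : ∀ r : ℤ, -17 ≤ r → r ≤ 17 → newd o z φ ρ x (j + r) = newd o z φ ρ x' (j' + r)) :
    T o z φ ρ x j = T o z φ ρ x' j' := by
  by_cases h : Cov o z x j
  · obtain ⟨i, d, h, h1, h2⟩ := h
    have e := hd (i - j) (by omega) (by omega)
    have e' := hn (i - j) (by omega) (by omega)
    rw [show j + (i - j) = i by ring] at e e'
    have h' : Occ o z x' (j' + (i - j)) d := by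
      rw [← dec_some hoz, ← e, dec_some hoz]
      exact h
    rw [T_cov hoz h h1 h2, T_cov hoz h' (by omega) (by omega), e']
    congr 1
    ring
  · have h' : ¬ Cov o z x' j' := by
      rintro ⟨i, d, h', h1, h2⟩
      apply h
      have e := hd (i - j') (by omega) (by omega)
      rw [show j' + (i - j') = i by ring] at e
      refine ⟨j + (i - j'), d, ?_, by omega, by omega⟩
      rw [← dec_some hoz, e, dec_some hoz]
      exact h'
    rw [T_uncov h, T_uncov h', hx]

theorem T_shift (hoz : o ≠ z) {φ : Y → Y} {ρ : Y → ℤ → Equiv.Perm Q} (H : Nice φ ρ)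
    (x : ℤ → Γ) : T o z φ ρ (shiftMapZ Γ x) = shiftMapZ Γ (T o z φ ρ x) := by
  have hd : ∀ i, dec o z (shiftMapZ Γ x) i = dec o z x (i + 1) := fun i =>
    dec_congr hoz fun r _ _ => by
      unfold shiftMapZ
      congr 1
      ring
  have hC : dC o z (shiftMapZ Γ x) = fun i => dC o z x (i + 1) := by
    funext i
    simp only [dC, hd]
  funext j
  change _ = T o z φ ρ x (j + 1)
  refine T_congr hoz rfl (fun r _ _ => ?_) (fun r _ _ => ?_)
  · rw [hd]
    congr 1
    ring
  · rw [show j + 1 + r = (j + r) + 1 by ring]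
    simp only [newd, hC, H.eqφ, H.eqρ, dQ, hd]

theorem T_local (hoz : o ≠ z) {φ : Y → Y} {ρ : Y → ℤ → Equiv.Perm Q} (H : Nice φ ρ)
    (x x' : ℤ → Γ) (j : ℤ) (h : ∀ i, j - 100 ≤ i → i ≤ j + 100 → x i = x' i) :
    T o z φ ρ x j = T o z φ ρ x' j := by
  have hd : ∀ i, j - 50 ≤ i → i ≤ j + 50 → dec o z x i = dec o z x' i := fun i _ _ =>
    dec_congr hoz fun r _ _ => h _ (by omega) (by omega)
  have hC : ∀ i, j - 50 ≤ i → i ≤ j + 50 → dC o z x i = dC o z x' i := fun i h1 h2 => by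
    simp only [dC, hd i h1 h2]
  refine T_congr hoz (h j (by omega) (by omega)) (fun r _ _ => hd _ (by omega) (by omega))
    (fun r _ _ => ?_)
  simp only [newd, dQ]
  rw [hd _ (by omega) (by omega),
    H.locφ _ (dC o z x') _ fun i h1 h2 => hC i (by omega) (by omega),
    H.locρ _ (dC o z x') _ fun i h1 h2 => hC i (by omega) (by omega)]

theorem T_cont [TopologicalSpace Γ] [DiscreteTopology Γ] (hoz : o ≠ z) {φ : Y → Y}
    {ρ : Y → ℤ → Equiv.Perm Q} (H : Nice φ ρ) : Continuous (T o z φ ρ) := by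
  refine continuous_pi fun j => ?_
  refine IsLocallyConstant.continuous ?_
  rw [IsLocallyConstant.iff_exists_open]
  intro x
  refine ⟨(Set.Icc (j - 100) (j + 100)).pi fun i => {x i}, ?_, ?_, ?_⟩
  · exact isOpen_set_pi (Set.finite_Icc _ _) fun i _ => isOpen_discrete _
  · intro i _
    rfl
  · intro x' hx'
    exact T_local hoz H _ _ _ fun i h1 h2 => hx' i ⟨h1, h2⟩

theorem T_inv (hoz : o ≠ z) {φ φ' : Y → Y} {ρ ρ' : Y → ℤ → Equiv.Perm Q} (H : Nice φ ρ)
    (H' : Nice φ' ρ') (h : ∀ y, φ (φ' y) = y) (hr : ∀ y i, ρ (φ' y) i * ρ' y i = 1) (x : ℤ → Γ) :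
    T o z φ ρ (T o z φ' ρ' x) = x := by
  have h1 := (T_rel hoz (ρ := ρ) H.supp).comp hoz (T_rel hoz (ρ := ρ') H'.supp)
  simp only [h, hr] at h1
  exact congrFun (h1.unique hoz Rel.id) x

theorem exists_aut [TopologicalSpace Γ] [DiscreteTopology Γ] (hoz : o ≠ z) (φ φ' : Y → Y)
    (ρ ρ' : Y → ℤ → Equiv.Perm Q) (H : Nice φ ρ)
    (H' : Nice φ' ρ') (h : ∀ y, φ (φ' y) = y) (hr : ∀ y i, ρ (φ' y) i * ρ' y i = 1)
    (h' : ∀ y, φ' (φ y) = y) (hr' : ∀ y i, ρ' (φ y) i * ρ y i = 1) :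
    ∃ f : CAut {shiftMapZ Γ}, Rel o z φ ρ (f : Equiv.Perm (ℤ → Γ)) := by
  refine ⟨⟨⟨T o z φ ρ, T o z φ' ρ', T_inv hoz H' H h' hr', T_inv hoz H H' h hr⟩, ?_, ?_⟩,
    T_rel hoz H.supp⟩
  · refine ⟨T_cont hoz H, ?_⟩
    rintro s rfl x
    exact T_shift hoz H x
  · refine ⟨T_cont hoz H', ?_⟩
    rintro s rfl x
    exact T_shift hoz H' x

/-! ### The generators -/

def mapA (y : Y) : Y := fun i => (y i).map Prod.swap

def mapB (y : Y) : Y := fun i =>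
  (y i).map fun c => ((y (i - 17)).elim c.1 Prod.snd, (y (i + 17)).elim c.2 Prod.fst)

theorem mapA_mapA (y : Y) : mapA (mapA y) = y := by
  funext i
  simp [mapA]

theorem mapB_mapB (y : Y) : mapB (mapB y) = y := by
  funext i
  rcases h0 : y i with _ | ⟨t, b⟩
  · simp [mapB, h0]
  · rcases h1 : y (i - 17) with _ | ⟨t1, b1⟩ <;> rcases h2 : y (i + 17) with _ | ⟨t2, b2⟩ <;>
      simp [mapB, h0, h1, h2]

def sft : Equiv.Perm Y where
  toFun y := mapA (mapB y)
  invFun y := mapB (mapA y)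
  left_inv y := by dsimp only; rw [mapA_mapA, mapB_mapB]
  right_inv y := by dsimp only; rw [mapB_mapB, mapA_mapA]

def rho (π : Equiv.Perm Q) (y : Y) (i : ℤ) : Equiv.Perm Q :=
  if (y i).map Prod.fst = some true then π else 1

theorem niceA : Nice mapA fun _ _ => 1 := by
  refine ⟨?_, ?_, fun _ _ => rfl, ?_, fun _ _ _ _ => rfl⟩
  · intro y i
    simp [mapA]
  · intro y i
    simp [mapA]
  · intro y y' i h
    simp only [mapA]
    rw [h i (by omega) (by omega)]

theorem niceB : Nice mapB fun _ _ => 1 := by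
  refine ⟨?_, ?_, fun _ _ => rfl, ?_, fun _ _ _ _ => rfl⟩
  · intro y i
    simp [mapB]
  · intro y i
    simp only [mapB]
    rw [show i - 17 + 1 = i + 1 - 17 by ring, show i + 17 + 1 = i + 1 + 17 by ring]
  · intro y y' i h
    simp only [mapB]
    rw [h i (by omega) (by omega), h (i - 17) (by omega) (by omega),
      h (i + 17) (by omega) (by omega)]

theorem niceG (π : Equiv.Perm Q) : Nice id (rho π) := by
  refine ⟨fun _ _ => rfl, fun _ _ => rfl, fun _ _ => rfl, ?_, ?_⟩
  · intro y y' i h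
    exact h i (by omega) (by omega)
  · intro y y' i h
    simp only [rho]
    rw [h i (by omega) (by omega)]

theorem rho_mul (π π' : Equiv.Perm Q) (y : Y) (i : ℤ) :
    rho π y i * rho π' y i = rho (π * π') y i := by
  unfold rho
  split_ifs <;> simp

theorem rho_one (y : Y) (i : ℤ) : rho 1 y i = 1 := by
  unfold rho
  split_ifs <;> rfl

theorem exists_s [TopologicalSpace Γ] [DiscreteTopology Γ] (hoz : o ≠ z) :
    ∃ f : CAut {shiftMapZ Γ}, Rel o z sft (fun _ _ => 1) (f : Equiv.Perm (ℤ → Γ)) := by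
  obtain ⟨a, ha⟩ := exists_aut hoz mapA mapA (fun _ _ => 1) (fun _ _ => 1) niceA niceA mapA_mapA
    (by simp) mapA_mapA (by simp)
  obtain ⟨b, hb⟩ := exists_aut hoz mapB mapB (fun _ _ => 1) (fun _ _ => 1) niceB niceB mapB_mapB
    (by simp) mapB_mapB (by simp)
  refine ⟨a * b, ?_⟩
  have := ha.comp hoz hb
  simp only [mul_one] at this
  exact this

theorem exists_g [TopologicalSpace Γ] [DiscreteTopology Γ] (hoz : o ≠ z) (π : Equiv.Perm Q) :
    ∃ f : CAut {shiftMapZ Γ}, Rel o z id (rho π) (f : Equiv.Perm (ℤ → Γ)) :=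
  exists_aut hoz id id (rho π) (rho π⁻¹) (niceG _) (niceG _) (fun _ => rfl)
    (fun y i => by simp [rho_mul, rho_one]) (fun _ => rfl) (fun y i => by simp [rho_mul, rho_one])

theorem Rel.one : Rel o z (1 : Equiv.Perm Y) (fun _ _ => 1) (1 : Equiv.Perm (ℤ → Γ)) := Rel.id

theorem Rel.mul (hoz : o ≠ z) {φ φ' : Equiv.Perm Y} {ρ ρ' : Y → ℤ → Equiv.Perm Q}
    {h h' : Equiv.Perm (ℤ → Γ)} (H : Rel o z φ ρ h) (H' : Rel o z φ' ρ' h') :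
    Rel o z (φ * φ' : Equiv.Perm Y) (fun y i => ρ (φ' y) i * ρ' y i)
      (h * h' : Equiv.Perm (ℤ → Γ)) := by
  have := Rel.comp hoz H H'
  exact this

theorem Rel.inv (hoz : o ≠ z) {φ : Equiv.Perm Y} {ρ : Y → ℤ → Equiv.Perm Q}
    {h : Equiv.Perm (ℤ → Γ)} (H : Rel o z φ ρ h) :
    Rel o z (φ⁻¹ : Equiv.Perm Y) (fun y i => (ρ (φ⁻¹ y) i)⁻¹) (h⁻¹ : Equiv.Perm (ℤ → Γ)) := by
  have hc : ∀ x, dC o z (h⁻¹ x) = φ⁻¹ (dC o z x) := fun x => by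
    rw [Equiv.Perm.eq_inv_iff_eq, ← H.c]
    simp
  refine ⟨hc, fun x i => ?_, fun x j hj => ?_⟩
  · have := H.q (h⁻¹ x) i
    rw [hc] at this
    rw [show h (h⁻¹ x) = x from h.apply_symm_apply x] at this
    rw [this, Option.map_map]
    cases dQ o z (h⁻¹ x) i <;> simp
  · have h1 := H.cov hoz (h⁻¹ x) j
    rw [show h (h⁻¹ x) = x from h.apply_symm_apply x] at h1
    rw [h1] at hj
    have := H.u _ _ hj
    rw [show h (h⁻¹ x) = x from h.apply_symm_apply x] at this
    exact this.symm

theorem Rel.pow (hoz : o ≠ z) {ρ : Y → ℤ → Equiv.Perm Q}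
    {h : Equiv.Perm (ℤ → Γ)} (H : Rel o z (1 : Equiv.Perm Y) ρ h) (n : ℕ) :
    Rel o z (1 : Equiv.Perm Y) (fun y i => ρ y i ^ n) (h ^ n : Equiv.Perm (ℤ → Γ)) := by
  induction n with
  | zero => simpa using Rel.one
  | succ n ih =>
    have := ih.mul hoz H
    rw [mul_one] at this
    simpa only [pow_succ, Equiv.Perm.one_apply] using this

theorem Rel.zpow (hoz : o ≠ z) {φ : Equiv.Perm Y}
    {h : Equiv.Perm (ℤ → Γ)} (H : Rel o z φ (fun _ _ => 1) h) (n : ℕ) :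
    Rel o z (φ ^ n : Equiv.Perm Y) (fun _ _ => 1) (h ^ n : Equiv.Perm (ℤ → Γ)) := by
  induction n with
  | zero => simpa using Rel.one
  | succ n ih =>
    have := ih.mul hoz H
    simpa only [pow_succ, mul_one] using this

variable (o z) in
/-- Skew products over powers of `sft`. -/
def skew (hoz : o ≠ z) : Subgroup (Equiv.Perm (ℤ → Γ)) where
  carrier := {h | ∃ (n : ℤ) (ρ : Y → ℤ → Equiv.Perm Q), Rel o z (sft ^ n : Equiv.Perm Y) ρ h}
  one_mem' := ⟨0, _, by simpa using Rel.one⟩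
  mul_mem' := by
    rintro a b ⟨n, ρ, h⟩ ⟨m, ρ', h'⟩
    refine ⟨n + m, fun y i => ρ ((sft ^ m) y) i * ρ' y i, ?_⟩
    rw [zpow_add]
    exact h.mul hoz h'
  inv_mem' := by
    rintro a ⟨n, ρ, h⟩
    refine ⟨-n, fun y i => (ρ ((sft ^ n)⁻¹ y) i)⁻¹, ?_⟩
    rw [zpow_neg]
    exact h.inv hoz

theorem skew_law (hoz : o ≠ z) {f g : Equiv.Perm (ℤ → Γ)} (hf : f ∈ skew o z hoz)
    (hg : g ∈ skew o z hoz) : (f * g * f⁻¹ * g⁻¹) ^ Fintype.card (Equiv.Perm Q) = 1 := by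
  obtain ⟨n, ρ, h⟩ := hf
  obtain ⟨m, ρ', h'⟩ := hg
  have H := ((h.mul hoz h').mul hoz (h.inv hoz)).mul hoz (h'.inv hoz)
  have e : sft ^ n * sft ^ m * (sft ^ n)⁻¹ * (sft ^ m)⁻¹ = 1 := by group
  rw [e] at H
  have H2 := H.pow hoz (Fintype.card (Equiv.Perm Q))
  simp only [pow_card_eq_one] at H2
  exact DFunLike.coe_injective (H2.unique hoz Rel.one)

def yy (m : ℤ) : Y := fun i => if i % 17 = 0 then some (decide (i = 17 * m), false) else none

theorem sft_yy (m : ℤ) : sft (yy m) = yy (m - 1) := by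
  funext i
  change mapA (mapB (yy m)) i = _
  by_cases h : i % 17 = 0
  · have h1 : (i - 17) % 17 = 0 := by omega
    have h2 : (i + 17) % 17 = 0 := by omega
    simp only [mapA, mapB, yy, if_pos h, if_pos h1, if_pos h2]
    simp
    omega
  · simp only [mapA, mapB, yy, if_neg h]
    rfl

theorem sft_pow_yy (n : ℕ) (m : ℤ) : (sft ^ n) (yy m) = yy (m - n) := by
  induction n with
  | zero => simp
  | succ n ih =>
    rw [pow_succ', Equiv.Perm.mul_apply, ih, sft_yy]
    congr 1
    push_cast
    ring

theorem rho_yy (π : Equiv.Perm Q) (m : ℤ) : rho π (yy m) 0 = if m = 0 then π else 1 := by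
  unfold rho yy
  have : ((0 : ℤ) = 17 * m) ↔ m = 0 := by omega
  simp [this]

theorem exists_x (hoz : o ≠ z) (m : ℤ) (q : Q) :
    ∃ x : ℤ → Γ, dC o z x = yy m ∧ dQ o z x 0 = some q := by
  let x : ℤ → Γ := fun j => enc o z ((decide (j / 17 = m), false), q) (j % 17)
  have hx : ∀ i, i % 17 = 0 → Occ o z x i ((decide (i = 17 * m), false), q) := by
    intro i hi r h0 h1
    change enc o z ((decide ((i + r) / 17 = m), false), q) ((i + r) % 17) = _
    have e1 : (i + r) % 17 = r := by omega
    have e2 : ((i + r) / 17 = m) ↔ i = 17 * m := by omega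
    simp only [e1, e2]
  refine ⟨x, ?_, ?_⟩
  · funext i
    unfold dC yy
    split_ifs with h
    · rw [(dec_some hoz).2 (hx i h)]
      rfl
    · rcases hd : dec o z x i with _ | d
      · rfl
      · exfalso
        rw [dec_some hoz] at hd
        exact occ_overlap hoz (hx (17 * (i / 17)) (by omega)) hd (by omega) (by omega)
  · unfold dQ
    rw [(dec_some hoz).2 (hx 0 rfl)]
    rfl

end enc

theorem solv_of_rel {P G : Type*} [Group P] [Group G] [Group.IsSolvable G] (S : Subgroup (P × G))
    (surj : ∀ p, ∃ g, (p, g) ∈ S) (h : ∀ p, (p, 1) ∈ S → p = 1) : Group.IsSolvable P := by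
  have i : Function.Injective ((MonoidHom.snd P G).comp S.subtype) := by
    rw [injective_iff_map_eq_one]
    rintro ⟨⟨p, g⟩, hs⟩ hg
    change g = 1 at hg
    subst hg
    have := h p hs
    subst this
    rfl
  have s : Function.Surjective ((MonoidHom.fst P G).comp S.subtype) := by
    intro p
    obtain ⟨g, hg⟩ := surj p
    exact ⟨⟨(p, g), hg⟩, rfl⟩
  have := Group.isSolvable_of_isSolvable_injective i
  exact Group.isSolvable_of_surjective s

theorem free_law (N : ℕ) (hN : N ≠ 0) :
    (FreeGroup.of (0 : Fin 2) * FreeGroup.of 1 * (FreeGroup.of 0)⁻¹ * (FreeGroup.of 1)⁻¹) ^ N ≠ 1 := by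
  intro h
  rw [pow_eq_one_iff_left hN] at h
  have := congrArg (FreeGroup.lift
    (![Equiv.swap 0 1, Equiv.swap 1 2] : Fin 2 → Equiv.Perm (Fin 3))) h
  simp only [map_mul, map_inv, FreeGroup.lift_apply_of, map_one] at this
  revert this
  decide

theorem main (Γ : Type) [TopologicalSpace Γ] [DiscreteTopology Γ]
    (o z : Γ) (hoz : o ≠ z) :
    ∃ H : Subgroup (CAut {shiftMapZ Γ}), H.FG ∧
      (¬∃ K : Subgroup H, K.FiniteIndex ∧ Group.IsSolvable K) ∧
      ¬∃ K : Subgroup H, Nonempty (K ≃* FreeGroup (Fin 2)) := by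
  obtain ⟨s, hs⟩ := exists_s (Γ := Γ) hoz
  choose g hg using exists_g (Γ := Γ) hoz
  let H : Subgroup (CAut {shiftMapZ Γ}) := Subgroup.closure ({s} ∪ Set.range g)
  have sH : s ∈ H := Subgroup.subset_closure (Or.inl rfl)
  have gH : ∀ π, g π ∈ H := fun π => Subgroup.subset_closure (Or.inr ⟨π, rfl⟩)
  have hH : H ≤ (skew o z hoz).subgroupOf (CAut {shiftMapZ Γ}) := by
    rw [Subgroup.closure_le]
    rintro f (rfl | ⟨π, rfl⟩)
    · exact ⟨1, _, by simpa using hs⟩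
    · exact ⟨0, _, by simpa using hg π⟩
  refine ⟨H, ?_, ?_, ?_⟩
  · rw [Subgroup.fg_iff]
    exact ⟨_, rfl, (Set.finite_singleton s).union (Set.finite_range g)⟩
  · rintro ⟨K, hK, hsol⟩
    let s' : H := ⟨s, sH⟩
    let g' : Equiv.Perm Q → H := fun π => ⟨g π, gH π⟩
    let v : ℕ → Equiv.Perm Q → H := fun n π => (s' ^ n)⁻¹ * g' π * s' ^ n
    have hv : ∀ n π, Rel o z (1 : Equiv.Perm Y) (fun y i => rho π ((sft ^ n) y) i)
        ((v n π : CAut {shiftMapZ Γ}) : Equiv.Perm (ℤ → Γ)) := by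
      intro n π
      have hs2 := hs.zpow hoz n
      have hg2 : Rel o z (1 : Equiv.Perm Y) (rho π) _ := hg π
      have := ((hs2.inv hoz).mul hoz hg2).mul hoz hs2
      have e : (sft ^ n)⁻¹ * 1 * sft ^ n = 1 := by group
      rw [e] at this
      simp only [inv_one, one_mul, mul_one] at this
      exact this
    have : Finite (H ⧸ K) := Subgroup.finite_quotient_of_finiteIndex
    obtain ⟨n, m, hnm, hvv⟩ := Finite.exists_ne_map_eq_of_infinite
      (fun (n : ℕ) (π : Equiv.Perm Q) => (QuotientGroup.mk (v n π) : H ⧸ K))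
    have hmem : ∀ π, (v n π)⁻¹ * v m π ∈ K := fun π => QuotientGroup.eq.1 (congrFun hvv π)
    let S : Subgroup (Equiv.Perm Q × K) :=
      { carrier := {p | ∃ (φ : Equiv.Perm Y) (ρ : Y → ℤ → Equiv.Perm Q),
          Rel o z φ ρ (((p.2 : H) : CAut {shiftMapZ Γ}) : Equiv.Perm (ℤ → Γ)) ∧
            φ (yy m) = yy m ∧ ρ (yy m) 0 = p.1}
        one_mem' := ⟨1, _, Rel.one, rfl, rfl⟩
        mul_mem' := by
          rintro a b ⟨φ, ρ, h1, h2, h3⟩ ⟨φ', ρ', h1', h2', h3'⟩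
          refine ⟨_, _, h1.mul hoz h1', ?_, ?_⟩
          · rw [Equiv.Perm.mul_apply, h2', h2]
          · simp only [h2', h3, h3']
            rfl
        inv_mem' := by
          rintro a ⟨φ, ρ, h1, h2, h3⟩
          have : φ⁻¹ (yy m) = yy m := by
            rw [Equiv.Perm.inv_eq_iff_eq, h2]
          refine ⟨_, _, h1.inv hoz, this, ?_⟩
          simp only [this, h3]
          rfl }
    refine Equiv.Perm.not_isSolvable_fin_5 (solv_of_rel S ?_ ?_)
    · intro π
      refine ⟨⟨_, hmem π⟩, _, _, ((hv n π).inv hoz).mul hoz (hv m π), by simp, ?_⟩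
      have : (m : ℤ) - n ≠ 0 := by omega
      simp [sft_pow_yy, rho_yy, this]
    · rintro τ ⟨φ, ρ, h1, h2, h3⟩
      ext1 q
      obtain ⟨x, hx, hq⟩ := exists_x hoz m q
      have := h1.q x 0
      rw [hx, h3] at this
      change dQ o z x 0 = _ at this
      rw [hq] at this
      simpa using this.symm
  · rintro ⟨K, ⟨e⟩⟩
    apply free_law (Fintype.card (Equiv.Perm Q)) Fintype.card_ne_zero
    apply e.symm.injective
    simp only [map_pow, map_mul, map_inv, map_one]
    apply Subtype.ext
    apply Subtype.ext
    apply Subtype.ext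
    exact skew_law hoz (hH (e.symm (FreeGroup.of 0)).1.2) (hH (e.symm (FreeGroup.of 1)).1.2)

end Tits

theorem stmt0 (Γ : Type) [Fintype Γ] [TopologicalSpace Γ] [DiscreteTopology Γ]
    (hΓ : 2 ≤ Fintype.card Γ) :
    ∃ H : Subgroup (CAut {shiftMapZ Γ}), H.FG ∧
      (¬∃ K : Subgroup H, K.FiniteIndex ∧ IsSolvable K) ∧
      ¬∃ K : Subgroup H, Nonempty (K ≃* FreeGroup (Fin 2)) := by
  obtain ⟨o, z, hoz⟩ := Fintype.one_lt_card_iff.1 (show 1 < Fintype.card Γ by omega)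
  exact Tits.main Γ o z hoz
end

section
/- For every finite alphabet Σ with at least eight elements, the group Aut(Σ^ℕ) does not satisfy the Tits alternative: Aut(Σ^ℕ) has a finitely generated subgroup which is not virtually solvable and which contains no subgroup isomorphic to the free group on two generators. -/
def shiftMapN (A : Type*) : (ℕ → A) → (ℕ → A) := fun x i => x (i + 1)

section AbstractPart

open scoped commutatorElement

theorem free_comm_pow_ne (n : ℕ) (hn : n ≠ 0) :
    (⁅FreeGroup.of (0 : Fin 2), FreeGroup.of (1 : Fin 2)⁆) ^ n ≠ 1 := by
  intro h
  have h1 : ⁅FreeGroup.of (0 : Fin 2), FreeGroup.of (1 : Fin 2)⁆ = 1 := by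
    exact (pow_eq_one_iff_left hn).1 h
  rw [commutatorElement_eq_one_iff_mul_comm] at h1
  revert h1
  decide

variable {G P Y : Type} [Group G] [Group P] (j : G →* P)
  (Φ : (Y → Equiv.Perm (Fin 5)) →* P) (g : G) (f : Equiv.Perm (Fin 5) → G) (γ : Equiv.Perm Y)

def HGrp : Subgroup G := Subgroup.closure (insert g (Set.range f))

theorem HGrp_fg : (HGrp g f).FG :=
  ⟨(Set.toFinite (insert g (Set.range f))).toFinset, by simp [HGrp]⟩

theorem conj_pow_aux (hγ : ∀ c : Y → Equiv.Perm (Fin 5), (j g)⁻¹ * Φ c * j g = Φ (c ∘ γ))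
    (k : ℕ) (c : Y → Equiv.Perm (Fin 5)) :
    (j g ^ k)⁻¹ * Φ c * j g ^ k = Φ (c ∘ ⇑(γ ^ k)) := by
  induction k generalizing c with
  | zero => simp
  | succ k ih =>
    have : (j g ^ (k+1))⁻¹ * Φ c * j g ^ (k+1)
        = (j g ^ k)⁻¹ * ((j g)⁻¹ * Φ c * j g) * j g ^ k := by
      rw [pow_succ']; group
    rw [this, hγ, ih, pow_succ']
    rfl

theorem mem_norm (hγ : ∀ c : Y → Equiv.Perm (Fin 5), (j g)⁻¹ * Φ c * j g = Φ (c ∘ γ)) :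
    j g ∈ Subgroup.normalizer (Φ.range : Set P) := by
  rw [Subgroup.mem_normalizer_iff]
  intro h
  constructor
  · rintro ⟨c, rfl⟩
    refine ⟨c ∘ ⇑γ⁻¹, ?_⟩
    have := hγ (c ∘ ⇑γ⁻¹)
    have h2 : (c ∘ ⇑γ⁻¹) ∘ ⇑γ = c := by ext y; simp
    rw [h2] at this
    rw [← this]; group
  · rintro ⟨c, hc⟩
    refine ⟨c ∘ γ, ?_⟩
    rw [← hγ, hc]; group

theorem HGrp_form (hγ : ∀ c : Y → Equiv.Perm (Fin 5), (j g)⁻¹ * Φ c * j g = Φ (c ∘ γ))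
    (hf : ∀ π, j (f π) ∈ Φ.range) (h : G) (hh : h ∈ HGrp g f) :
    ∃ k : ℤ, ∃ n ∈ Φ.range, j h = n * j g ^ k := by
  have key : ∀ k : ℤ, ∀ n ∈ Φ.range, j g ^ k * n * (j g ^ k)⁻¹ ∈ Φ.range := by
    intro k n hn
    exact (Subgroup.mem_normalizer_iff.1
      (Subgroup.zpow_mem _ (mem_norm j Φ g γ hγ) k) n).1 hn
  unfold HGrp at hh
  induction hh using Subgroup.closure_induction with
  | mem x hx =>
    rcases hx with rfl | ⟨π, rfl⟩
    · exact ⟨1, 1, one_mem _, by simp⟩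
    · exact ⟨0, _, hf π, by simp⟩
  | one => exact ⟨0, 1, one_mem _, by simp⟩
  | mul x y _ _ hx hy =>
    obtain ⟨k, n, hn, hx⟩ := hx
    obtain ⟨l, m, hm, hy⟩ := hy
    refine ⟨k + l, n * (j g ^ k * m * (j g ^ k)⁻¹), mul_mem hn (key k m hm), ?_⟩
    rw [map_mul, hx, hy, zpow_add]; group
  | inv x _ hx =>
    obtain ⟨k, n, hn, hx⟩ := hx
    refine ⟨-k, _, key (-k) n⁻¹ (inv_mem hn), ?_⟩
    rw [map_inv, hx]; group

theorem HGrp_comm (hγ : ∀ c : Y → Equiv.Perm (Fin 5), (j g)⁻¹ * Φ c * j g = Φ (c ∘ γ))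
    (hf : ∀ π, j (f π) ∈ Φ.range) (x y : G) (hx : x ∈ HGrp g f) (hy : y ∈ HGrp g f) :
    j ⁅x, y⁆ ∈ Φ.range := by
  have key : ∀ k : ℤ, ∀ n ∈ Φ.range, j g ^ k * n * (j g ^ k)⁻¹ ∈ Φ.range := by
    intro k n hn
    exact (Subgroup.mem_normalizer_iff.1
      (Subgroup.zpow_mem _ (mem_norm j Φ g γ hγ) k) n).1 hn
  obtain ⟨k, n, hn, hx⟩ := HGrp_form j Φ g f γ hγ hf x hx
  obtain ⟨l, m, hm, hy⟩ := HGrp_form j Φ g f γ hγ hf y hy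
  have : j ⁅x, y⁆ = n * (j g ^ k * m * (j g ^ k)⁻¹) * (j g ^ l * n⁻¹ * (j g ^ l)⁻¹) * m⁻¹ := by
    rw [map_commutatorElement, hx, hy, commutatorElement_def]; group
  rw [this]
  exact mul_mem (mul_mem (mul_mem hn (key _ _ hm)) (key _ _ (inv_mem hn))) (inv_mem hm)

theorem HGrp_no_free (hj : Function.Injective j)
    (hγ : ∀ c : Y → Equiv.Perm (Fin 5), (j g)⁻¹ * Φ c * j g = Φ (c ∘ γ))
    (hf : ∀ π, j (f π) ∈ Φ.range) :
    ¬∃ K : Subgroup (HGrp g f), Nonempty (K ≃* FreeGroup (Fin 2)) := by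
  rintro ⟨K, ⟨e⟩⟩
  let a := e.symm (FreeGroup.of 0)
  let b := e.symm (FreeGroup.of 1)
  obtain ⟨c, hc⟩ := HGrp_comm j Φ g f γ hγ hf a.1.1 b.1.1 a.1.2 b.1.2
  have h1 : j (⁅a.1.1, b.1.1⁆ ^ Fintype.card (Equiv.Perm (Fin 5))) = 1 := by
    rw [map_pow, ← hc, ← map_pow]
    have : c ^ Fintype.card (Equiv.Perm (Fin 5)) = 1 := by
      funext y
      rw [Pi.pow_apply, pow_card_eq_one]; rfl
    rw [this, map_one]
  have h2 : ⁅a.1.1, b.1.1⁆ ^ Fintype.card (Equiv.Perm (Fin 5)) = 1 := hj (by rw [h1, map_one])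
  have h3 : ⁅a, b⁆ ^ Fintype.card (Equiv.Perm (Fin 5)) = 1 := by
    apply Subtype.ext; apply Subtype.ext
    exact h2
  have h4 := congrArg e h3
  rw [map_pow, map_commutatorElement, map_one] at h4
  simp only [a, b, MulEquiv.apply_symm_apply] at h4
  exact free_comm_pow_ne _ Fintype.card_ne_zero h4

open Classical in
theorem HGrp_not_virt_solvable (hj : Function.Injective j)
    (hγ : ∀ c : Y → Equiv.Perm (Fin 5), (j g)⁻¹ * Φ c * j g = Φ (c ∘ γ)) (U : Set Y)
    (hf : ∀ π, j (f π) = Φ (fun y => if y ∈ U then π else 1))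
    (hsep : ∀ k l : ℕ, k < l → ∃ y, (∀ c, Φ c = 1 → c y = 1) ∧ (γ ^ k) y ∉ U ∧ (γ ^ l) y ∈ U) :
    ¬∃ K : Subgroup (HGrp g f), K.FiniteIndex ∧ Group.IsSolvable K := by
  rintro ⟨K, hK, hs⟩
  have hg : g ∈ HGrp g f := Subgroup.subset_closure (Set.mem_insert _ _)
  have hfm : ∀ π, f π ∈ HGrp g f := fun π =>
    Subgroup.subset_closure (Set.mem_insert_of_mem _ ⟨π, rfl⟩)
  let g' : HGrp g f := ⟨g, hg⟩
  let f' : Equiv.Perm (Fin 5) → HGrp g f := fun π => ⟨f π, hfm π⟩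
  let h : ℕ → Equiv.Perm (Fin 5) → HGrp g f := fun k π => (g' ^ k)⁻¹ * f' π * g' ^ k
  have hjh : ∀ k π, j (h k π) = Φ (fun y => if (γ ^ k) y ∈ U then π else 1) := by
    intro k π
    have h1 : ((h k π : HGrp g f) : G) = (g ^ k)⁻¹ * f π * g ^ k := rfl
    rw [h1, map_mul, map_mul, map_inv, map_pow, hf, conj_pow_aux j Φ g γ hγ]
    rfl
  let F : ℕ → (Equiv.Perm (Fin 5) → HGrp g f ⧸ K) := fun k π => (h k π : HGrp g f ⧸ K)
  have hex : ∃ k l : ℕ, k < l ∧ F k = F l := by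
    obtain ⟨k, l, hkl, he⟩ := Finite.exists_ne_map_eq_of_infinite F
    rcases lt_or_gt_of_ne hkl with h | h
    · exact ⟨k, l, h, he⟩
    · exact ⟨l, k, h, he.symm⟩
  obtain ⟨k, l, hkl, he⟩ := hex
  obtain ⟨y, hy, hyk, hyl⟩ := hsep k l hkl
  let J : HGrp g f →* P := j.comp (HGrp g f).subtype
  have hJ : Function.Injective J := hj.comp Subtype.val_injective
  let KP : Subgroup P := K.map J
  have hKP : Group.IsSolvable KP := by
    have : Group.IsSolvable (K.map J) := Group.isSolvable_of_surjective (J.subgroupMap_surjective K)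
    exact this
  let C : Subgroup (Y → Equiv.Perm (Fin 5)) := KP.comap Φ
  let φ : C →* KP := Φ.subgroupComap KP
  let ev : C →* Equiv.Perm (Fin 5) := (Pi.evalMonoidHom _ y).comp C.subtype
  have hker : φ.ker ≤ ev.ker := by
    intro c hc
    rw [MonoidHom.mem_ker] at hc ⊢
    exact hy c.1 (congrArg Subtype.val hc)
  have s1 : Group.IsSolvable (C ⧸ φ.ker) :=
    Group.isSolvable_of_isSolvable_injective (QuotientGroup.kerLift_injective φ)
  have hsurj : Function.Surjective (QuotientGroup.lift φ.ker ev hker) := by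
    intro π
    have hm : (h k π)⁻¹ * h l π ∈ K := QuotientGroup.eq.1 (congrFun he π)
    let c : Y → Equiv.Perm (Fin 5) := (fun y => if (γ ^ k) y ∈ U then π else 1)⁻¹ *
      (fun y => if (γ ^ l) y ∈ U then π else 1)
    have hc : c ∈ C := by
      refine ⟨_, hm, ?_⟩
      change j ((h k π : G)⁻¹ * (h l π : G)) = _
      rw [map_mul, map_inv, hjh, hjh, map_mul, map_inv]
    refine ⟨QuotientGroup.mk ⟨c, hc⟩, ?_⟩
    rw [QuotientGroup.lift_mk]
    change c y = π
    simp [c, hyk, hyl]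
  exact Equiv.Perm.not_isSolvable_fin_5 (Group.isSolvable_of_surjective hsurj)

end AbstractPart

section Concrete

variable {Γ : Type}

open Classical in
/-- Swap `u` and `v` at each cell whose right neighbour is `w`. -/
noncomputable def ctrl (u v w : Γ) (x : ℕ → Γ) : ℕ → Γ :=
  fun i => if x (i + 1) = w then Equiv.swap u v (x i) else x i

theorem ctrl_invol {u v w : Γ} (h1 : w ≠ u) (h2 : w ≠ v) (x : ℕ → Γ) :
    ctrl u v w (ctrl u v w x) = x := by
  classical
  have key : ∀ i, ctrl u v w x i = w ↔ x i = w := by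
    intro i
    unfold ctrl
    split_ifs
    · rw [Equiv.apply_eq_iff_eq_symm_apply, Equiv.symm_swap, Equiv.swap_apply_of_ne_of_ne h1 h2]
    · rfl
  funext i
  rw [ctrl]
  simp only [key]
  unfold ctrl
  split_ifs <;> simp

noncomputable def ctrlPerm (u v w : Γ) (h1 : w ≠ u) (h2 : w ≠ v) : Equiv.Perm (ℕ → Γ) :=
  ⟨ctrl u v w, ctrl u v w, ctrl_invol h1 h2, ctrl_invol h1 h2⟩

theorem cont_local [TopologicalSpace Γ] [DiscreteTopology Γ] (F : (ℕ → Γ) → (ℕ → Γ))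
    (loc : ℕ → Γ → Γ → Γ) (hF : ∀ x i, F x i = loc i (x i) (x (i + 1))) : Continuous F := by
  refine continuous_pi fun i => ?_
  have h : (fun x => F x i) = (fun p : Γ × Γ => loc i p.1 p.2) ∘
      (fun x : ℕ → Γ => (x i, x (i + 1))) := by
    funext x; exact hF x i
  rw [h]
  exact continuous_of_discreteTopology.comp
    ((continuous_apply i).prodMk (continuous_apply (i + 1)))

theorem ctrlPerm_mem [TopologicalSpace Γ] [DiscreteTopology Γ] (u v w : Γ)
    (h1 : w ≠ u) (h2 : w ≠ v) : ctrlPerm u v w h1 h2 ∈ CAut {shiftMapN Γ} := by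
  classical
  have h : CommCont {shiftMapN Γ} (ctrlPerm u v w h1 h2) := by
    refine ⟨cont_local _ (fun _ a b => if b = w then Equiv.swap u v a else a)
      (fun x i => by simp [ctrlPerm, ctrl]), ?_⟩
    rintro s rfl x
    rfl
  exact ⟨h, h⟩

variable (ι : Fin 5 ↪ Γ)

open Classical in
/-- Collapse the five special symbols. -/
noncomputable def coll (s : Γ) : Γ := if s ∈ Set.range ι then ι 0 else s

noncomputable def ρ : Equiv.Perm (Fin 5) →* Equiv.Perm Γ := Equiv.Perm.viaEmbeddingHom ι

theorem ρ_out (π : Equiv.Perm (Fin 5)) {s : Γ} (hs : s ∉ Set.range ι) : ρ ι π s = s :=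
  Equiv.Perm.viaEmbedding_apply_of_notMem π ι s hs

theorem ρ_in (π : Equiv.Perm (Fin 5)) (a : Fin 5) : ρ ι π (ι a) = ι (π a) :=
  Equiv.Perm.viaEmbedding_apply π ι a

theorem coll_ρ (π : Equiv.Perm (Fin 5)) (s : Γ) : coll ι (ρ ι π s) = coll ι s := by
  by_cases hs : s ∈ Set.range ι
  · obtain ⟨a, rfl⟩ := hs
    rw [ρ_in]; simp [coll]
  · rw [ρ_out ι π hs]

theorem coll_out {s : Γ} (hs : s ∉ Set.range ι) : coll ι s = s := by
  rw [coll, if_neg hs]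

theorem coll_eq_iff {w : Γ} (hw : w ∉ Set.range ι) (s : Γ) : coll ι s = w ↔ s = w := by
  by_cases hs : s ∈ Set.range ι
  · rw [coll, if_pos hs]
    constructor
    · rintro rfl; exact absurd ⟨0, rfl⟩ hw
    · rintro rfl; exact absurd hs hw
  · rw [coll_out ι hs]

/-- Collapsed tail of `x` from position `i`. -/
noncomputable def tl (x : ℕ → Γ) (i : ℕ) : ℕ → Γ := fun n => coll ι (x (i + n))

noncomputable def ΦFun (c : (ℕ → Γ) → Equiv.Perm (Fin 5)) (x : ℕ → Γ) : ℕ → Γ :=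
  fun i => ρ ι (c (tl ι x i)) (x i)

theorem tl_ΦFun (c : (ℕ → Γ) → Equiv.Perm (Fin 5)) (x : ℕ → Γ) (i : ℕ) :
    tl ι (ΦFun ι c x) i = tl ι x i := by
  funext n
  simp only [tl, ΦFun, coll_ρ]

theorem ΦFun_mul (c d : (ℕ → Γ) → Equiv.Perm (Fin 5)) (x : ℕ → Γ) :
    ΦFun ι (c * d) x = ΦFun ι c (ΦFun ι d x) := by
  funext i
  rw [ΦFun, ΦFun, tl_ΦFun, Pi.mul_apply, map_mul]
  rfl

theorem ΦFun_one (x : ℕ → Γ) : ΦFun ι 1 x = x := by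
  funext i
  rw [ΦFun, Pi.one_apply, map_one]
  rfl

noncomputable def ΦHom : ((ℕ → Γ) → Equiv.Perm (Fin 5)) →* Equiv.Perm (ℕ → Γ) where
  toFun c := ⟨ΦFun ι c, ΦFun ι c⁻¹,
    fun x => by rw [← ΦFun_mul, inv_mul_cancel, ΦFun_one],
    fun x => by rw [← ΦFun_mul, mul_inv_cancel, ΦFun_one]⟩
  map_one' := by ext1 x; exact ΦFun_one ι x
  map_mul' c d := by ext1 x; exact ΦFun_mul ι c d x

theorem swap_comm_ρ [DecidableEq Γ] {u v : Γ} (hu : u ∉ Set.range ι) (hv : v ∉ Set.range ι)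
    (π : Equiv.Perm (Fin 5)) (s : Γ) :
    Equiv.swap u v (ρ ι π s) = ρ ι π (Equiv.swap u v s) := by
  by_cases hs : s ∈ Set.range ι
  · obtain ⟨a, rfl⟩ := hs
    have : ∀ b, Equiv.swap u v (ι b) = ι b := fun b =>
      Equiv.swap_apply_of_ne_of_ne (fun h => hu ⟨b, h⟩) (fun h => hv ⟨b, h⟩)
    rw [ρ_in, this, this, ρ_in]
  · rw [ρ_out ι π hs, ρ_out]
    rw [Equiv.swap_apply_def]
    split_ifs <;> assumption

theorem swap_comm_coll [DecidableEq Γ] {u v : Γ} (hu : u ∉ Set.range ι) (hv : v ∉ Set.range ι)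
    (s : Γ) : Equiv.swap u v (coll ι s) = coll ι (Equiv.swap u v s) := by
  have : ∀ b, Equiv.swap u v (ι b) = ι b := fun b =>
      Equiv.swap_apply_of_ne_of_ne (fun h => hu ⟨b, h⟩) (fun h => hv ⟨b, h⟩)
  by_cases hs : s ∈ Set.range ι
  · obtain ⟨a, rfl⟩ := hs
    simp [coll, this]
  · rw [coll_out ι hs, coll_out]
    rw [Equiv.swap_apply_def]
    split_ifs <;> assumption

theorem tl_ctrl {u v w : Γ} (hu : u ∉ Set.range ι) (hv : v ∉ Set.range ι) (hw : w ∉ Set.range ι)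
    (x : ℕ → Γ) (i : ℕ) : tl ι (ctrl u v w x) i = ctrl u v w (tl ι x i) := by
  classical
  funext n
  simp only [tl, ctrl, coll_eq_iff ι hw, swap_comm_coll ι hu hv, ← add_assoc]
  split_ifs <;> rfl

theorem ρ_eq_iff {w : Γ} (hw : w ∉ Set.range ι) (π : Equiv.Perm (Fin 5)) (s : Γ) :
    ρ ι π s = w ↔ s = w := by
  constructor
  · intro h
    apply (ρ ι π).injective
    rw [h, ρ_out ι π hw]
  · rintro rfl; exact ρ_out ι π hw

theorem ctrl_conj {u v w : Γ} (h1 : w ≠ u) (h2 : w ≠ v)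
    (hu : u ∉ Set.range ι) (hv : v ∉ Set.range ι) (hw : w ∉ Set.range ι)
    (c : (ℕ → Γ) → Equiv.Perm (Fin 5)) :
    (ctrlPerm u v w h1 h2)⁻¹ * ΦHom ι c * ctrlPerm u v w h1 h2
      = ΦHom ι (c ∘ ctrlPerm u v w h1 h2) := by
  classical
  rw [mul_assoc, inv_mul_eq_iff_eq_mul]
  ext x i
  change ΦFun ι c (ctrl u v w x) i = ctrl u v w (ΦFun ι (c ∘ ctrl u v w) x) i
  simp only [ΦFun, tl_ctrl ι hu hv hw, ctrl, ρ_eq_iff ι hw, swap_comm_ρ ι hu hv,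
    Function.comp_apply]
  split_ifs <;> rfl

open Classical in
/-- The controlled permutation: acts where the right neighbour is `w`. -/
theorem ΦHom_mem [TopologicalSpace Γ] [DiscreteTopology Γ] {w : Γ} (hw : w ∉ Set.range ι)
    (π : Equiv.Perm (Fin 5)) :
    ΦHom ι (fun y => if y ∈ {y : ℕ → Γ | y 1 = w} then π else 1) ∈ CAut {shiftMapN Γ} := by
  have h : ∀ π : Equiv.Perm (Fin 5), CommCont {shiftMapN Γ}
      (ΦHom ι (fun y => if y ∈ {y : ℕ → Γ | y 1 = w} then π else 1)) := by
    intro π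
    refine ⟨cont_local _ (fun _ a b => if b = w then ρ ι π a else a) (fun x i => ?_), ?_⟩
    · change ρ ι (if tl ι x i 1 = w then π else 1) (x i) = _
      simp only [tl, coll_eq_iff ι hw]
      split_ifs
      · rfl
      · rw [map_one]; rfl
    · rintro s rfl x
      funext i
      change ρ ι _ _ = ρ ι _ _
      have : tl ι (shiftMapN Γ x) i = tl ι x (i + 1) := by
        funext n
        simp only [tl, shiftMapN]
        congr 2; omega
      rw [this]
      rfl
  refine ⟨h π, ?_⟩
  have := h π⁻¹
  rw [← map_inv]
  convert this using 2
  funext y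
  rw [Pi.inv_apply]
  split_ifs
  · rfl
  · exact inv_one

theorem ΦHom_detect (y : ℕ → Γ) (h0 : y 0 = ι 0) (hy : ∀ n, coll ι (y n) = y n)
    (c : (ℕ → Γ) → Equiv.Perm (Fin 5)) (hc : ΦHom ι c = 1) : c y = 1 := by
  have key : ∀ a, c y a = a := by
    intro a
    let x : ℕ → Γ := fun n => if n = 0 then ι a else y n
    have ht : tl ι x 0 = y := by
      funext n
      simp only [tl, x, zero_add]
      split_ifs with hn
      · subst hn; rw [h0]; simp [coll]
      · exact hy n
    have h : ΦFun ι c x 0 = x 0 := congrFun (congrArg (fun e : Equiv.Perm (ℕ → Γ) => e x) hc) 0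
    rw [ΦFun, ht] at h
    simp only [x, if_true, ρ_in] at h
    exact ι.injective h
  ext1 a
  exact key a

theorem front_step {s0 s1 s2 : Γ} (h01 : s0 ≠ s1) (h02 : s0 ≠ s2) (h12 : s1 ≠ s2)
    (z : ℕ → Γ) (m : ℕ) (hz : ∀ n, 1 ≤ n → n < m + 2 → z n = s0) (hm : z (m + 2) = s2) :
    (∀ n, 1 ≤ n → n < m → ctrl s0 s2 s1 (ctrl s0 s1 s2 z) n = s0) ∧
    (1 ≤ m → ctrl s0 s2 s1 (ctrl s0 s1 s2 z) m = s2) := by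
  classical
  have a1 : ∀ n, 1 ≤ n → n < m + 1 → ctrl s0 s1 s2 z n = s0 := by
    intro n hn hn'
    rw [ctrl, hz (n+1) (by omega) (by omega), if_neg h02, hz n hn (by omega)]
  have a2 : ctrl s0 s1 s2 z (m+1) = s1 := by
    rw [ctrl, hm, if_pos rfl, hz (m+1) (by omega) (by omega), Equiv.swap_apply_left]
  constructor
  · intro n hn hn'
    rw [ctrl, a1 (n+1) (by omega) (by omega), if_neg h01, a1 n hn (by omega)]
  · intro hm1
    rw [ctrl, a2, if_pos rfl, a1 m hm1 (by omega), Equiv.swap_apply_left]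

theorem front_iter {s0 s1 s2 : Γ} (h01 : s0 ≠ s1) (h02 : s0 ≠ s2) (h12 : s1 ≠ s2)
    (A : Equiv.Perm (ℕ → Γ)) (hA : ∀ x, A x = ctrl s0 s2 s1 (ctrl s0 s1 s2 x))
    (k : ℕ) : ∀ (z : ℕ → Γ) (r : ℕ), (∀ n, 1 ≤ n → n < 2 * (k + r) + 1 → z n = s0) →
      z (2 * (k + r) + 1) = s2 →
      (∀ n, 1 ≤ n → n < 2 * r + 1 → (A ^ k) z n = s0) ∧ (A ^ k) z (2 * r + 1) = s2 := by
  induction k with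
  | zero => intro z r h1 h2; simp only [zero_add] at h1 h2; simpa using ⟨fun n hn hn2 => h1 n hn (by omega), h2⟩
  | succ k ih =>
    intro z r h1 h2
    have hs := front_step h01 h02 h12 z (2 * (k + r) + 1)
      (fun n hn hn' => h1 n hn (by omega)) (by rw [← h2]; congr 1; omega)
    rw [← hA] at hs
    rw [pow_succ, Equiv.Perm.mul_apply]
    exact ih (A z) r hs.1 (hs.2 (by omega))

end Concrete

theorem stmt1 (Γ : Type) [Fintype Γ] [TopologicalSpace Γ] [DiscreteTopology Γ]
    (hΓ : 8 ≤ Fintype.card Γ) :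
    ∃ H : Subgroup (CAut {shiftMapN Γ}), H.FG ∧
      (¬∃ K : Subgroup H, K.FiniteIndex ∧ IsSolvable K) ∧
      ¬∃ K : Subgroup H, Nonempty (K ≃* FreeGroup (Fin 2)) := by
  classical
  obtain ⟨e⟩ : Nonempty (Fin 8 ↪ Γ) :=
    Function.Embedding.nonempty_of_card_le (by simpa using hΓ)
  let ι : Fin 5 ↪ Γ := (Fin.castLEEmb (by norm_num : 5 ≤ 8)).trans e
  have hout : ∀ b : Fin 8, 5 ≤ b.val → e b ∉ Set.range ι := by
    rintro b hb ⟨a, ha⟩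
    have h1 : Fin.castLE (by norm_num : 5 ≤ 8) a = b := e.injective ha
    have h2 := congrArg Fin.val h1
    simp at h2
    omega
  have o0 := hout 5 (by decide)
  have o1 := hout 6 (by decide)
  have o2 := hout 7 (by decide)
  have h01 : e 5 ≠ e 6 := e.injective.ne (by decide)
  have h02 : e 5 ≠ e 7 := e.injective.ne (by decide)
  have h12 : e 6 ≠ e 7 := e.injective.ne (by decide)
  generalize e 5 = s0 at *
  generalize e 6 = s1 at *
  generalize e 7 = s2 at *
  let a := ctrlPerm s0 s1 s2 h02.symm h12.symm
  let b := ctrlPerm s0 s2 s1 h01.symm h12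
  let A : Equiv.Perm (ℕ → Γ) := b * a
  have hA : ∀ x, A x = ctrl s0 s2 s1 (ctrl s0 s1 s2 x) := fun x => rfl
  let g : CAut {shiftMapN Γ} := ⟨A, mul_mem (ctrlPerm_mem _ _ _ _ _) (ctrlPerm_mem _ _ _ _ _)⟩
  let f : Equiv.Perm (Fin 5) → CAut {shiftMapN Γ} := fun π => ⟨_, ΦHom_mem ι o2 π⟩
  have hγ : ∀ c : (ℕ → Γ) → Equiv.Perm (Fin 5),
      ((CAut {shiftMapN Γ}).subtype g)⁻¹ * ΦHom ι c * (CAut {shiftMapN Γ}).subtype g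
        = ΦHom ι (c ∘ A) := by
    intro c
    change (b * a)⁻¹ * ΦHom ι c * (b * a) = _
    have : (b * a)⁻¹ * ΦHom ι c * (b * a) = a⁻¹ * (b⁻¹ * ΦHom ι c * b) * a := by group
    rw [this, ctrl_conj ι _ _ o0 o2 o1, ctrl_conj ι _ _ o0 o1 o2]
    rfl
  refine ⟨HGrp g f, HGrp_fg g f, ?_, ?_⟩
  · refine HGrp_not_virt_solvable (CAut {shiftMapN Γ}).subtype (ΦHom ι) g f A
      Subtype.val_injective hγ {y | y 1 = s2} (fun π => rfl) ?_
    intro k l hkl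
    let y : ℕ → Γ := fun n => if n = 0 then ι 0 else if n = 2 * l + 1 then s2 else s0
    have y1 : ∀ n, 1 ≤ n → n < 2 * l + 1 → y n = s0 := by
      intro n hn hn'
      simp only [y]
      rw [if_neg (by omega), if_neg (by omega)]
    have y2 : y (2 * l + 1) = s2 := by simp [y]
    refine ⟨y, ΦHom_detect ι y rfl ?_, ?_, ?_⟩
    · intro n
      simp only [y]
      split_ifs
      · simp [coll]
      · exact coll_out ι o2
      · exact coll_out ι o0
    · have := (front_iter h01 h02 h12 A hA k y (l - k)
        (fun n hn hn' => y1 n hn (by omega)) (by rw [← y2]; congr 1; omega)).1 1 le_rfl (by omega)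
      rw [Set.mem_setOf_eq, this]
      exact h02
    · exact (front_iter h01 h02 h12 A hA l y 0 (fun n hn hn' => y1 n hn (by omega)) y2).2
  · exact HGrp_no_free (CAut {shiftMapN Γ}).subtype (ΦHom ι) g f A
      Subtype.val_injective hγ (fun π => ⟨_, rfl⟩)
end

section
/- Let H be a finitely generated group such that for infinitely many natural numbers n the group A_5^n is a subquotient of H, i.e. there exist a subgroup K of H and a surjective group homomorphism from K onto the direct product Fin n → A_5. Then H is not virtually solvable: H has no solvable subgroup of finite index. -/
/-- The alternating group on five letters. -/
abbrev A5 : Type := alternatingGroup (Fin 5)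

theorem a5_not_solvable : ¬ Group.IsSolvable A5 := by
  intro h
  have : IsSimpleGroup A5 := by
    first
      | infer_instance
      | exact alternatingGroup.isSimpleGroup (by simp)
  have hc := IsSimpleGroup.comm_iff_isSolvable.mpr h
  have := hc ⟨Equiv.swap 0 1 * Equiv.swap 1 2, by rw [Equiv.Perm.mem_alternatingGroup]; decide⟩ ⟨Equiv.swap 0 1 * Equiv.swap 1 3, by rw [Equiv.Perm.mem_alternatingGroup]; decide⟩
  revert this
  decide

theorem a5_normal_solvable (M : Subgroup A5) [M.Normal] (h : Group.IsSolvable M) : M = ⊥ := by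
  have : IsSimpleGroup A5 := by
    first
      | infer_instance
      | exact alternatingGroup.isSimpleGroup (by simp)
  rcases Subgroup.Normal.eq_bot_or_eq_top (H := M) inferInstance with h1 | h1
  · exact h1
  · subst h1
    exact absurd (Group.isSolvable_of_surjective (f := (Subgroup.topEquiv (G := A5)).toMonoidHom)
      Subgroup.topEquiv.surjective) a5_not_solvable

theorem stmt2 (H : Type*) [Group H] (hfg : Group.FG H)
    (hsub : {n : ℕ |
      ∃ (K : Subgroup H) (φ : K →* (Fin n → A5)), Function.Surjective φ}.Infinite) :
    ¬∃ K : Subgroup H, K.FiniteIndex ∧ IsSolvable K := by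
  rintro ⟨S, hS, hsol0⟩
  have hsol : Group.IsSolvable S := hsol0
  obtain ⟨n, ⟨K, φ, hφ⟩, hn⟩ := hsub.exists_gt S.normalCore.index
  set N := S.normalCore with hN
  have hNsol : Group.IsSolvable N :=
    Group.isSolvable_of_isSolvable_injective (Subgroup.inclusion_injective S.normalCore_le)
  have hNK : Group.IsSolvable (N.subgroupOf K) := by
    let f : N.subgroupOf K →* N :=
      { toFun := fun x => ⟨x.1.1, x.2⟩, map_one' := rfl, map_mul' := fun _ _ => rfl }
    refine Group.isSolvable_of_isSolvable_injective (f := f) ?_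
    intro x y hxy
    exact Subtype.ext (Subtype.ext (congrArg (fun z : N => (z : H)) hxy))
  have hle : N.subgroupOf K ≤ φ.ker := by
    intro x hx
    rw [MonoidHom.mem_ker]
    funext i
    let ψ : K →* A5 := (Pi.evalMonoidHom (fun _ : Fin n => A5) i).comp φ
    have hψ : Function.Surjective ψ := (Function.surjective_eval i).comp hφ
    have : ((N.subgroupOf K).map ψ).Normal := Subgroup.Normal.map inferInstance ψ hψ
    have hb := a5_normal_solvable ((N.subgroupOf K).map ψ)
      (Group.isSolvable_of_surjective (f := ψ.subgroupMap (N.subgroupOf K))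
        (ψ.subgroupMap_surjective _))
    have : ψ x ∈ (N.subgroupOf K).map ψ := Subgroup.mem_map_of_mem _ hx
    rw [hb] at this
    exact this
  have hfi : N.index ≠ 0 := Subgroup.FiniteIndex.index_ne_zero
  have h1 : φ.ker.index ≤ N.index := by
    refine le_trans (Nat.le_of_dvd ?_ (Subgroup.index_dvd_of_le hle)) ?_
    · exact Nat.pos_of_ne_zero Subgroup.FiniteIndex.index_ne_zero
    · exact Nat.le_of_dvd (Nat.pos_of_ne_zero hfi) (Subgroup.relIndex_dvd_index_of_normal N K)
  rw [Subgroup.index_ker, MonoidHom.range_eq_top.mpr hφ, Subgroup.card_top, Nat.card_fun,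
    Nat.card_fin] at h1
  have h2 : n < Nat.card A5 ^ n := Nat.lt_pow_self Finite.one_lt_card
  omega
end

section
/- Let N be an infinite set of positive integers. Then the group A_5 ⟅^N ℤ satisfies the law ⁅g, h⁆^30 = 1: for all elements g, h of A_5 ⟅^N ℤ, the 30th power of the commutator g⁻¹h⁻¹gh is the identity. Consequently, A_5 ⟅^N ℤ contains no subgroup isomorphic to the free group on two generators. -/
/-- The disjoint union `⨆_{n ∈ N} G^n`. -/
abbrev SN (G : Type*) (N : Set ℕ) : Type _ := Σ n : N, Fin (n : ℕ) → G

/-- The permutation of `⨆_{n ∈ N} G^n` multiplying the first coordinate on the left by `a`. -/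
def rho {G : Type*} [Group G] {N : Set ℕ} (a : G) : Equiv.Perm (SN G N) :=
  Equiv.sigmaCongrRight fun _n =>
    Equiv.piCongrRight fun i => if (i : ℕ) = 0 then Equiv.mulLeft a else Equiv.refl G

/-- The permutation of `⨆_{n ∈ N} G^n` rotating each tuple:
`(g_1, …, g_n) ↦ (g_2, …, g_n, g_1)`. -/
def rot (G : Type*) (N : Set ℕ) : Equiv.Perm (SN G N) :=
  Equiv.sigmaCongrRight fun n => (Equiv.arrowCongr (finRotate (n : ℕ)) (Equiv.refl G)).symm

/-- The group `G ⟅^N ℤ`: the subgroup of permutations of `⨆_{n ∈ N} G^n` generated by the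
rotation `↻` together with the `ρ_a`, `a ∈ G`. -/
def WreathZ (G : Type*) [Group G] (N : Set ℕ) : Subgroup (Equiv.Perm (SN G N)) :=
  Subgroup.closure (insert (rot G N) (Set.range (rho (G := G) (N := N))))

theorem rot_mem {G : Type*} [Group G] {N : Set ℕ} : rot G N ∈ WreathZ G N :=
  Subgroup.subset_closure (Set.mem_insert _ _)

theorem rho_mem {G : Type*} [Group G] {N : Set ℕ} (a : G) :
    rho (G := G) (N := N) a ∈ WreathZ G N :=
  Subgroup.subset_closure (Set.mem_insert_of_mem _ ⟨a, rfl⟩)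

/-- `g` acts on each tuple by a shift by `k` followed by coordinatewise left multiplication. -/
def ShiftBy {G : Type*} [Group G] {N : Set ℕ} (k : ℤ) (g : Equiv.Perm (SN G N)) : Prop :=
  ∃ c : ∀ n : N, Fin (n : ℕ) → G, ∀ (n : N) (f : Fin (n : ℕ) → G),
    g ⟨n, f⟩ = ⟨n, fun i => c n i * f ((finRotate (n : ℕ) ^ k) i)⟩

theorem ShiftBy.mul {G : Type*} [Group G] {N : Set ℕ} {k l : ℤ} {g h : Equiv.Perm (SN G N)}
    (hg : ShiftBy k g) (hh : ShiftBy l h) : ShiftBy (l + k) (g * h) := by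
  obtain ⟨c, hc⟩ := hg
  obtain ⟨d, hd⟩ := hh
  refine ⟨fun n i => c n i * d n ((finRotate (n : ℕ) ^ k) i), fun n f => ?_⟩
  rw [Equiv.Perm.mul_apply, hd, hc]
  simp only [zpow_add, Equiv.Perm.mul_apply, mul_assoc]

theorem ShiftBy.inv {G : Type*} [Group G] {N : Set ℕ} {k : ℤ} {g : Equiv.Perm (SN G N)}
    (hg : ShiftBy k g) : ShiftBy (-k) g⁻¹ := by
  obtain ⟨c, hc⟩ := hg
  refine ⟨fun n i => (c n ((finRotate (n : ℕ) ^ (-k)) i))⁻¹, fun n f => ?_⟩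
  rw [Equiv.Perm.inv_eq_iff_eq, hc]
  simp only [← Equiv.Perm.mul_apply, ← zpow_add, neg_add_cancel, zpow_zero,
    Equiv.Perm.one_apply, mul_inv_cancel_left]

theorem exists_shiftBy {G : Type*} [Group G] {N : Set ℕ} {g : Equiv.Perm (SN G N)}
    (hg : g ∈ WreathZ G N) : ∃ k : ℤ, ShiftBy k g := by
  unfold WreathZ at hg
  induction hg using Subgroup.closure_induction with
  | mem x hx =>
    rcases hx with rfl | ⟨a, rfl⟩
    · refine ⟨1, fun _ _ => 1, fun n f => ?_⟩
      simp only [zpow_one, one_mul]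
      rfl
    · refine ⟨0, fun _ i => if (i : ℕ) = 0 then a else 1, fun n f => ?_⟩
      simp only [rho, Equiv.sigmaCongrRight_apply, zpow_zero, Equiv.Perm.one_apply]
      congr 1
      funext i
      by_cases hi : (i : ℕ) = 0 <;> simp [hi]
  | one => exact ⟨0, fun _ _ => 1, fun n f => by simp⟩
  | mul x y _ _ hx hy =>
    obtain ⟨k, hk⟩ := hx
    obtain ⟨l, hl⟩ := hy
    exact ⟨_, hk.mul hl⟩
  | inv x _ hx =>
    obtain ⟨k, hk⟩ := hx
    exact ⟨_, hk.inv⟩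

theorem A5_pow (a : A5) : a ^ 30 = 1 := by
  have h : ∀ a : Equiv.Perm (Fin 5), Equiv.Perm.sign a = 1 → a ^ 30 = 1 := by
    intro a ha
    have hsum : a.cycleType.sum ≤ 5 := by
      rw [Equiv.Perm.sum_cycleType]
      simpa using Finset.card_le_univ a.support
    rw [← orderOf_dvd_iff_pow_eq_one, ← Equiv.Perm.lcm_cycleType, Multiset.lcm_dvd]
    intro n hn
    have h2 : 2 ≤ n := Equiv.Perm.two_le_of_mem_cycleType hn
    have h5 : n ≤ 5 := (Multiset.le_sum_of_mem hn).trans hsum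
    by_cases h4 : n = 4
    · -- a cycle of length four would make `a` an odd permutation
      subst h4
      exfalso
      obtain ⟨t, ht⟩ := Multiset.exists_cons_of_mem hn
      have ht0 : t = 0 := by
        refine Multiset.eq_zero_of_forall_notMem fun m hm => ?_
        have hm2 : 2 ≤ m := Equiv.Perm.two_le_of_mem_cycleType (σ := a) (by
          rw [ht]
          exact Multiset.mem_cons_of_mem hm)
        have := Multiset.le_sum_of_mem hm
        rw [ht, Multiset.sum_cons] at hsum
        omega
      rw [Equiv.Perm.sign_of_cycleType, ht, ht0] at ha
      revert ha
      simp only [Multiset.cons_zero, Multiset.sum_singleton, Multiset.card_singleton]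
      decide
    · interval_cases n <;> first | omega | norm_num
  exact Subtype.ext (h a.1 (Equiv.Perm.mem_alternatingGroup.1 a.2))

theorem ShiftBy.pow_eq_one {G : Type*} [Group G] {N : Set ℕ} {g : Equiv.Perm (SN G N)}
    (hg : ShiftBy 0 g) {m : ℕ} (hm : ∀ a : G, a ^ m = 1) : g ^ m = 1 := by
  obtain ⟨c, hc⟩ := hg
  have key : ∀ (j : ℕ) (n : N) (f : Fin (n : ℕ) → G),
      (g ^ j) ⟨n, f⟩ = ⟨n, fun i => c n i ^ j * f i⟩ := by
    intro j
    induction j with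
    | zero => intro n f; simp
    | succ j ih =>
      intro n f
      rw [pow_succ', Equiv.Perm.mul_apply, ih, hc]
      simp [pow_succ', mul_assoc]
  ext1 ⟨n, f⟩
  rw [key]
  simp [hm]

theorem law (N : Set ℕ) (g h : WreathZ A5 N) : (g⁻¹ * h⁻¹ * g * h) ^ 30 = 1 := by
  obtain ⟨k, hk⟩ := exists_shiftBy g.2
  obtain ⟨l, hl⟩ := exists_shiftBy h.2
  have h0 := ((hk.inv.mul hl.inv).mul hk).mul hl
  rw [show l + (k + (-l + -k)) = 0 by ring] at h0
  exact Subtype.ext (h0.pow_eq_one A5_pow)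

theorem stmt3 (N : Set ℕ) (hpos : ∀ n ∈ N, 0 < n) (hinf : N.Infinite) :
    (∀ g h : WreathZ A5 N, (g⁻¹ * h⁻¹ * g * h) ^ 30 = 1) ∧
      ¬∃ K : Subgroup (WreathZ A5 N), Nonempty (K ≃* FreeGroup (Fin 2)) := by
  refine ⟨law N, ?_⟩
  rintro ⟨K, ⟨e⟩⟩
  let x : FreeGroup (Fin 2) := FreeGroup.of 0
  let y : FreeGroup (Fin 2) := FreeGroup.of 1
  have h1 : ((e.symm x)⁻¹ * (e.symm y)⁻¹ * e.symm x * e.symm y) ^ 30 = 1 :=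
    Subtype.ext (law N (e.symm x).1 (e.symm y).1)
  have h2 : (x⁻¹ * y⁻¹ * x * y) ^ 30 = 1 := by
    simpa using congrArg e h1
  have h3 : x⁻¹ * y⁻¹ * x * y = 1 := (pow_eq_one_iff_left (by norm_num)).1 h2
  exact absurd h3 (by decide)
end

section
/- Let N be a set of positive integers. For every n ∈ N, the group A_5^n = (Fin n → A_5) is a subquotient of A_5 ⟅^N ℤ: there exist a subgroup K of A_5 ⟅^N ℤ and a surjective group homomorphism from K onto Fin n → A_5. -/
/-- The tuples `h` whose left translation on the `n`-th component is induced by an element of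
the group. -/
def liftable (N : Set ℕ) (n : N) : Subgroup (Fin (n : ℕ) → A5) where
  carrier := {h | ∃ w : WreathZ A5 N, ∀ x, w.1 ⟨n, x⟩ = ⟨n, h * x⟩}
  one_mem' := ⟨1, fun x => by simp⟩
  mul_mem' := by
    rintro a b ⟨v, hv⟩ ⟨w, hw⟩
    refine ⟨v * w, fun x => ?_⟩
    simp [hw, hv, mul_assoc]
  inv_mem' := by
    rintro a ⟨v, hv⟩
    refine ⟨v⁻¹, fun x => ?_⟩
    have := hv (a⁻¹ * x)
    rw [mul_inv_cancel_left] at this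
    rw [Subgroup.coe_inv, Equiv.Perm.inv_eq_iff_eq, this]

theorem rot_apply (N : Set ℕ) (n : N) (x : Fin (n : ℕ) → A5) :
    rot A5 N ⟨n, x⟩ = ⟨n, x ∘ finRotate n⟩ := rfl

theorem liftable_rot (N : Set ℕ) (n : N) (h : Fin (n : ℕ) → A5) (hh : h ∈ liftable N n) :
    h ∘ (finRotate n).symm ∈ liftable N n := by
  obtain ⟨w, hw⟩ := hh
  refine ⟨⟨rot A5 N, rot_mem⟩⁻¹ * w * ⟨rot A5 N, rot_mem⟩, fun x => ?_⟩
  simp only [Subgroup.coe_mul, Subgroup.coe_inv, Equiv.Perm.mul_apply, rot_apply, hw]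
  rw [Equiv.Perm.inv_eq_iff_eq, rot_apply]
  congr 1
  funext i
  simp only [Function.comp, Pi.mul_apply, Equiv.symm_apply_apply]

theorem liftable_zero (N : Set ℕ) (n : N) (i : Fin (n : ℕ)) (hi : (i : ℕ) = 0) (a : A5) :
    Pi.mulSingle i a ∈ liftable N n := by
  refine ⟨⟨rho a, rho_mem a⟩, fun x => ?_⟩
  change (⟨n, _⟩ : SN A5 N) = _
  congr 1
  funext j
  by_cases hj : (j : ℕ) = 0
  · have : j = i := Fin.ext (by omega)
    subst this
    simp [hj]
  · have : j ≠ i := fun h => hj (h ▸ hi)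
    simp [hj, this]

theorem finRotate_aux (p k : ℕ) (hk : k + 1 < p) :
    finRotate p ⟨k, Nat.lt_of_succ_lt hk⟩ = ⟨k + 1, hk⟩ := by
  obtain ⟨m, rfl⟩ : ∃ m, p = m + 1 := ⟨p - 1, by omega⟩
  exact finRotate_of_lt (by omega)

theorem liftable_single (N : Set ℕ) (n : N) (a : A5) (k : ℕ) (hk : k < (n : ℕ)) :
    Pi.mulSingle (⟨k, hk⟩ : Fin (n : ℕ)) a ∈ liftable N n := by
  induction k with
  | zero => exact liftable_zero N n _ rfl a
  | succ k ih =>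
    have h := liftable_rot N n _ (ih (by omega))
    have e : finRotate (n : ℕ) ⟨k, by omega⟩ = ⟨k + 1, hk⟩ := finRotate_aux _ k hk
    convert h using 1
    funext j
    simp only [Function.comp, Pi.mulSingle_apply, Equiv.symm_apply_eq, e]

theorem liftable_top (N : Set ℕ) (n : N) (h : Fin (n : ℕ) → A5) : h ∈ liftable N n :=
  Subgroup.pi_mem_of_mulSingle_mem h fun i => liftable_single N n _ i.1 i.2

/-- The elements acting by a left translation on the `n`-th component. -/
def transl (N : Set ℕ) (n : N) : Subgroup (WreathZ A5 N) where
  carrier := {w | ∃ h : Fin (n : ℕ) → A5, ∀ x, w.1 ⟨n, x⟩ = ⟨n, h * x⟩}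
  one_mem' := ⟨1, fun x => by simp⟩
  mul_mem' := by
    rintro v w ⟨a, hv⟩ ⟨b, hw⟩
    refine ⟨a * b, fun x => ?_⟩
    simp [hw, hv, mul_assoc]
  inv_mem' := by
    rintro v ⟨a, hv⟩
    refine ⟨a⁻¹, fun x => ?_⟩
    have := hv (a⁻¹ * x)
    rw [mul_inv_cancel_left] at this
    rw [Subgroup.coe_inv, Equiv.Perm.inv_eq_iff_eq, this]

theorem transl_unique (N : Set ℕ) (n : N) (w : WreathZ A5 N) (h k : Fin (n : ℕ) → A5)
    (hh : ∀ x, w.1 ⟨n, x⟩ = ⟨n, h * x⟩) (hk : ∀ x, w.1 ⟨n, x⟩ = ⟨n, k * x⟩) : h = k := by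
  have := (hh 1).symm.trans (hk 1)
  simpa using this

theorem stmt5 (N : Set ℕ) (hpos : ∀ n ∈ N, 0 < n) (n : ℕ) (hn : n ∈ N) :
    ∃ (K : Subgroup (WreathZ A5 N)) (φ : K →* (Fin n → A5)), Function.Surjective φ := by
  let m : N := ⟨n, hn⟩
  choose f hf using fun w : transl N m => w.2
  refine ⟨transl N m, MonoidHom.mk' f fun v w => ?_, fun h => ?_⟩
  · refine transl_unique N m (v * w : transl N m) _ _ (hf _) fun x => ?_
    simp [hf, mul_assoc]
  · obtain ⟨w, hw⟩ := liftable_top N m h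
    exact ⟨⟨w, h, hw⟩, transl_unique N m w _ _ (hf ⟨w, h, hw⟩) hw⟩
end

section
/- Let G be a finite group and N a set of positive integers. Then the group G ⟅^N ℤ is residually finite: for every element g ≠ 1 of G ⟅^N ℤ there exist a finite group Q and a group homomorphism φ : G ⟅^N ℤ → Q with φ(g) ≠ 1. -/
theorem stmt6 (G : Type) [Group G] [Finite G] (N : Set ℕ) (hpos : ∀ n ∈ N, 0 < n)
    (g : WreathZ G N) (hg : g ≠ 1) :
    ∃ (Q : Type) (_ : Group Q), Finite Q ∧ ∃ φ : WreathZ G N →* Q, φ g ≠ 1 := by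
  let F := Equiv.Perm.sigmaCongrRightHom (fun n : N => Fin (n : ℕ) → G)
  have hF : Function.Injective F := Equiv.Perm.sigmaCongrRightHom_injective
  have hle : WreathZ G N ≤ F.range := by
    refine (Subgroup.closure_le _).2 ?_
    rintro x (rfl | ⟨a, rfl⟩)
    · exact ⟨fun n => (Equiv.arrowCongr (finRotate (n : ℕ)) (Equiv.refl G)).symm, rfl⟩
    · exact ⟨fun _n => Equiv.piCongrRight fun i =>
        if (i : ℕ) = 0 then Equiv.mulLeft a else Equiv.refl G, rfl⟩
  let ψ : WreathZ G N →* (∀ n : N, Equiv.Perm (Fin (n : ℕ) → G)) :=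
    (MonoidHom.ofInjective hF).symm.toMonoidHom.comp (Subgroup.inclusion hle)
  have hψ : Function.Injective ψ :=
    (MonoidHom.ofInjective hF).symm.injective.comp (Subgroup.inclusion_injective hle)
  have h1 : ψ g ≠ 1 := fun h => hg (hψ (h.trans (map_one ψ).symm))
  obtain ⟨n, hn⟩ := Function.ne_iff.1 h1
  exact ⟨Equiv.Perm (Fin (n : ℕ) → G), inferInstance, inferInstance,
    (Pi.evalMonoidHom _ n).comp ψ, hn⟩
end

section
/- There exists a finite alphabet Σ (one may take Σ with 26 elements, namely the disjoint union of a singleton {#} with the set of pairs from a 5-element set) together with an injective group homomorphism from A_5 ⟅^E ℤ into Aut(Σ^ℤ), where E = {2, 4, 6, …} is the set of positive even integers. -/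
open Equiv

namespace Belt

abbrev X : Type := Fin 5
abbrev Gam : Type := Option (X × X)

instance instTopGam : TopologicalSpace Gam := ⊥
instance instDiscGam : DiscreteTopology Gam := ⟨rfl⟩

/-- Free group on the generators: `none` is the rotation, `some a` is `ρ_a`. -/
abbrev F : Type := FreeGroup (Option A5)

section act
variable (Y : Type) [MulAction A5 Y] (m : ℕ)

/-- action of the generators on tuples -/
def gen : Option A5 → Perm (Fin m → Y)
  | none => (Equiv.arrowCongr (finRotate m) (Equiv.refl Y)).symm
  | some a => Equiv.piCongrRight fun i => if (i : ℕ) = 0 then MulAction.toPerm a else Equiv.refl Y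

def act : F →* Perm (Fin m → Y) := FreeGroup.lift (gen Y m)

theorem gen_none (y : Fin m → Y) (i : Fin m) : gen Y m none y i = y (finRotate m i) := rfl

theorem gen_some (a : A5) (y : Fin m → Y) (i : Fin m) :
    gen Y m (some a) y i = if (i : ℕ) = 0 then a • y i else y i := by
  simp only [gen, Equiv.piCongrRight_apply, Pi.map_apply]
  split_ifs <;> rfl

end act

theorem act_form (m : ℕ) (w : F) : ∃ (c : Fin m → A5) (s : Perm (Fin m)),
    ∀ (Y : Type) [MulAction A5 Y] (y : Fin m → Y) (i : Fin m),
      act Y m w y i = c i • y (s i) := by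
  induction w using FreeGroup.induction_on with
  | C1 => exact ⟨1, 1, fun Y _ y i => by simp⟩
  | of g =>
    cases g with
    | none => exact ⟨1, finRotate m, fun Y _ y i => by simp [act, gen_none]⟩
    | some a =>
      refine ⟨fun i => if (i : ℕ) = 0 then a else 1, 1, fun Y _ y i => ?_⟩
      simp only [act, FreeGroup.lift_apply_of, gen_some, Perm.one_apply]
      split_ifs <;> simp
  | inv_of g ih =>
    obtain ⟨c, s, h⟩ := ih
    refine ⟨fun i => (c (s⁻¹ i))⁻¹, s⁻¹, fun Y _ y i => ?_⟩
    have := h Y (act Y m (FreeGroup.of g)⁻¹ y) (s⁻¹ i)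
    rw [← Perm.mul_apply, ← map_mul] at this
    simp only [mul_inv_cancel, map_one, Perm.one_apply] at this
    rw [this]
    simp
  | mul u v hu hv =>
    obtain ⟨c, s, h⟩ := hu
    obtain ⟨d, t, k⟩ := hv
    refine ⟨fun i => c i * d (s i), t * s, fun Y _ y i => ?_⟩
    rw [map_mul, Perm.mul_apply, h, k, mul_smul, Perm.mul_apply]

/-- triviality of the action on tuples over a type implies triviality everywhere -/
theorem act_triv {m : ℕ} {w : F} {Z : Type} [MulAction A5 Z] (X' : Type) (e : X' → Z)
    (he : ∀ a : A5, (∀ x, a • e x = e x) → a = 1)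
    (p q : X') (hpq : e p ≠ e q)
    (h : ∀ y : Fin m → X', act Z m w (e ∘ y) = e ∘ y)
    (Y : Type) [MulAction A5 Y] : act Y m w = 1 := by
  obtain ⟨c, s, hcs⟩ := act_form m w
  have hc : ∀ i, c i = 1 := by
    intro i
    apply he
    intro x
    have := congrFun (h fun _ => x) i
    rw [hcs] at this
    exact this
  have hs : ∀ i, s i = i := by
    intro i
    by_contra hne
    have := congrFun (h fun j => if j = i then p else q) i
    rw [hcs, hc] at this
    simp [hne] at this
    exact hpq this.symm
  ext y i
  simp [hcs, hc, hs]

/-! Cellular automata -/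

def loc (f : Gam → Gam → Gam → Gam) (x : ℤ → Gam) : ℤ → Gam :=
  fun i => f (x (i - 1)) (x i) (x (i + 1))

theorem loc_cont (f : Gam → Gam → Gam → Gam) : Continuous (loc f) := by
  refine continuous_pi fun i => ?_
  have h : Continuous (fun p : Gam × Gam × Gam => f p.1 p.2.1 p.2.2) :=
    continuous_of_discreteTopology
  have h2 : Continuous (fun x : ℤ → Gam => (x (i - 1), x i, x (i + 1))) := by fun_prop
  exact h.comp h2

theorem loc_comm (f : Gam → Gam → Gam → Gam) (x : ℤ → Gam) :
    loc f (shiftMapZ Gam x) = shiftMapZ Gam (loc f x) := by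
  funext i
  simp [loc, shiftMapZ]

def fR : Gam → Gam → Gam → Gam
  | _, none, _ => none
  | p, some (t, b), n =>
    some ((match n with | none => b | some z => z.1), (match p with | none => t | some z => z.2))

def fL : Gam → Gam → Gam → Gam
  | _, none, _ => none
  | p, some (t, b), n =>
    some ((match p with | none => b | some z => z.1), (match n with | none => t | some z => z.2))

def fP (a : A5) : Gam → Gam → Gam → Gam
  | _, none, _ => none
  | none, some (t, b), _ => some (a • t, b)
  | some _, some (t, b), _ => some (t, b)

theorem fL_fR (x : ℤ → Gam) : loc fL (loc fR x) = x := by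
  funext i
  simp only [loc, sub_add_cancel, add_sub_cancel_right]
  rcases x (i - 1) with _ | ⟨a, b⟩ <;> rcases x i with _ | ⟨c, d⟩ <;>
    rcases x (i + 1) with _ | ⟨e, f⟩ <;> simp [fL, fR]

theorem fR_fL (x : ℤ → Gam) : loc fR (loc fL x) = x := by
  funext i
  simp only [loc, sub_add_cancel, add_sub_cancel_right]
  rcases x (i - 1) with _ | ⟨a, b⟩ <;> rcases x i with _ | ⟨c, d⟩ <;>
    rcases x (i + 1) with _ | ⟨e, f⟩ <;> simp [fL, fR]

theorem fP_fP (a b : A5) (hab : a * b = 1) (x : ℤ → Gam) : loc (fP a) (loc (fP b) x) = x := by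
  funext i
  simp only [loc, sub_add_cancel, add_sub_cancel_right]
  rcases x (i - 1 - 1) with _ | ⟨a, b⟩ <;>
  rcases x (i - 1) with _ | ⟨a, b⟩ <;> rcases x i with _ | ⟨c, d⟩ <;>
    rcases x (i + 1) with _ | ⟨e, f⟩ <;> simp [fP, smul_smul, hab]

def locPerm (f g : Gam → Gam → Gam → Gam) (h : ∀ x, loc f (loc g x) = x)
    (h' : ∀ x, loc g (loc f x) = x) : CAut {shiftMapZ Gam} :=
  ⟨⟨loc f, loc g, h', h⟩, ⟨loc_cont f, by rintro s rfl x; exact loc_comm f x⟩,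
    ⟨loc_cont g, by rintro s rfl x; exact loc_comm g x⟩⟩

def genB : Option A5 → CAut {shiftMapZ Gam}
  | none => locPerm fR fL fR_fL fL_fR
  | some a => locPerm (fP a) (fP a⁻¹) (fP_fP _ _ (by simp)) (fP_fP _ _ (by simp))

def beta : F →* CAut {shiftMapZ Gam} := FreeGroup.lift genB

def bet (w : F) (x : ℤ → Gam) : ℤ → Gam := (beta w : Perm (ℤ → Gam)) x

theorem bet_mul (u v : F) (x) : bet (u * v) x = bet u (bet v x) := by
  simp [bet]

theorem bet_one (x) : bet 1 x = x := by
  simp [bet]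

theorem bet_none (x) : bet (FreeGroup.of none) x = loc fR x := by
  simp only [bet, beta, FreeGroup.lift_apply_of]; rfl

theorem bet_some (a) (x) : bet (FreeGroup.of (some a)) x = loc (fP a) x := by
  simp only [bet, beta, FreeGroup.lift_apply_of]; rfl

theorem bet_cont (w : F) : Continuous (bet w) := (beta w).2.1.1

def Valid (l : ℤ) (n : ℕ) (x : ℤ → Gam) : Prop :=
  x l = none ∧ x (l + n + 1) = none ∧ ∀ i, l < i → i < l + n + 1 → x i ≠ none

def rd (l : ℤ) (n m : ℕ) (x : ℤ → Gam) (j : Fin m) : Option X :=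
  if (j : ℕ) < n then (x (l + 1 + (j : ℕ))).map Prod.fst else (x (l + m - (j : ℕ))).map Prod.snd

theorem finRotate_val {m : ℕ} (i : Fin m) :
    (finRotate m i : ℕ) = if (i : ℕ) + 1 = m then 0 else (i : ℕ) + 1 := by
  cases m with
  | zero => exact i.elim0
  | succ m =>
    split_ifs with h
    · have : i = Fin.last m := Fin.ext (by simpa using h)
      subst this; simp
    · rw [coe_finRotate_of_ne_last]
      rintro rfl; simp at h

theorem pres_gen (g : Option A5) (x : ℤ → Gam) (i : ℤ) :
    bet (FreeGroup.of g) x i = none ↔ x i = none := by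
  cases g with
  | none =>
    rw [bet_none, loc]
    rcases x i with _ | ⟨c, d⟩ <;> simp [fR]
  | some a =>
    rw [bet_some, loc]
    rcases x (i - 1) with _ | ⟨a, b⟩ <;> rcases x i with _ | ⟨c, d⟩ <;> simp [fP]

theorem rd_gen (l : ℤ) (n m : ℕ) (hm : m = n + n) (g : Option A5)
    (x : ℤ → Gam) (hv : Valid l n x) :
    rd l n m (bet (FreeGroup.of g) x) = gen (Option X) m g (rd l n m x) := by
  obtain ⟨h0, h1, h2⟩ := hv
  funext j
  have hj := j.2
  cases g with
  | none =>
    rw [gen_none, bet_none]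
    simp only [rd, finRotate_val, loc]
    by_cases hjn : (j : ℕ) < n
    · rw [if_pos hjn]
      obtain ⟨z, hz⟩ := Option.ne_none_iff_exists'.1
        (h2 (l + 1 + (j : ℕ)) (by omega) (by omega))
      by_cases hjn' : (j : ℕ) + 1 < n
      · obtain ⟨z', hz'⟩ := Option.ne_none_iff_exists'.1
          (h2 (l + 1 + (j : ℕ) + 1) (by omega) (by omega))
        rw [if_neg (show ¬((j : ℕ) + 1 = m) by omega), if_pos hjn',
          show l + 1 + (((j : ℕ) + 1 : ℕ) : ℤ) = l + 1 + (j : ℕ) + 1 by push_cast; ring, hz, hz']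
        simp [fR]
      · rw [if_neg (show ¬((j : ℕ) + 1 = m) by omega), if_neg hjn',
          show l + (m : ℤ) - (((j : ℕ) + 1 : ℕ) : ℤ) = l + 1 + (j : ℕ) by omega, hz,
          show l + 1 + ((j : ℕ) : ℤ) + 1 = l + n + 1 by omega, h1]
        simp [fR]
    · rw [if_neg hjn]
      obtain ⟨z, hz⟩ := Option.ne_none_iff_exists'.1
        (h2 (l + m - (j : ℕ)) (by omega) (by omega))
      by_cases hjn' : (j : ℕ) + 1 = m
      · rw [if_pos hjn', if_pos (by omega), hz,
          show l + (m : ℤ) - ((j : ℕ) : ℤ) - 1 = l by omega, h0,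
          show l + 1 + ((0 : ℕ) : ℤ) = l + m - (j : ℕ) by omega, hz]
        simp [fR]
      · obtain ⟨z', hz'⟩ := Option.ne_none_iff_exists'.1
          (h2 (l + m - (j : ℕ) - 1) (by omega) (by omega))
        rw [if_neg hjn', if_neg (by omega), hz, hz',
          show l + (m : ℤ) - (((j : ℕ) + 1 : ℕ) : ℤ) = l + m - (j : ℕ) - 1 by omega, hz']
        simp [fR]
  | some a =>
    rw [gen_some, bet_some]
    simp only [rd, loc]
    by_cases hjn : (j : ℕ) < n
    · simp only [if_pos hjn]
      obtain ⟨z, hz⟩ := Option.ne_none_iff_exists'.1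
        (h2 (l + 1 + (j : ℕ)) (by omega) (by omega))
      by_cases hj0 : (j : ℕ) = 0
      · rw [if_pos hj0, hz, show l + 1 + ((j : ℕ) : ℤ) - 1 = l by omega, h0]
        simp [fP]
      · obtain ⟨z', hz'⟩ := Option.ne_none_iff_exists'.1
          (h2 (l + 1 + (j : ℕ) - 1) (by omega) (by omega))
        rw [if_neg hj0, hz, hz']
        simp [fP]
    · have hj0 : (j : ℕ) ≠ 0 := by omega
      simp only [if_neg hjn, if_neg hj0]
      rcases x (l + m - (j : ℕ) - 1) with _ | ⟨a, b⟩ <;>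
        rcases x (l + m - (j : ℕ)) with _ | ⟨c, d⟩ <;> simp [fP]

theorem main_ind (w : F) : ∀ x : ℤ → Gam, (∀ i, bet w x i = none ↔ x i = none) ∧
    ∀ (l : ℤ) (n m : ℕ), m = n + n → Valid l n x →
      rd l n m (bet w x) = act (Option X) m w (rd l n m x) := by
  induction w using FreeGroup.induction_on with
  | C1 => intro x; simp [bet_one]
  | of g =>
    refine fun x => ⟨pres_gen g x, fun l n m hm hv => ?_⟩
    rw [rd_gen l n m hm g x hv]; simp [act]
  | inv_of g ih =>
    intro x
    have hx : bet (FreeGroup.of g) (bet (FreeGroup.of g)⁻¹ x) = x := by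
      rw [← bet_mul, mul_inv_cancel, bet_one]
    have hp : ∀ i, bet (FreeGroup.of g)⁻¹ x i = none ↔ x i = none := by
      intro i
      rw [← (ih (bet (FreeGroup.of g)⁻¹ x)).1 i, hx]
    refine ⟨hp, fun l n m hm hv => ?_⟩
    have := (ih (bet (FreeGroup.of g)⁻¹ x)).2 l n m hm
      ⟨(hp _).2 hv.1, (hp _).2 hv.2.1, fun i h h' h'' => hv.2.2 i h h' ((hp _).1 h'')⟩
    rw [hx] at this
    rw [this, ← Perm.mul_apply, ← map_mul]
    simp
  | mul u v hu hv =>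
    intro x
    have hp := (hv x).1
    refine ⟨fun i => by rw [bet_mul, (hu _).1, hp], fun l n m hm hV => ?_⟩
    rw [bet_mul, (hu _).2 l n m hm
      ⟨(hp _).2 hV.1, (hp _).2 hV.2.1, fun i h h' h'' => hV.2.2 i h h' ((hp _).1 h'')⟩,
      (hv _).2 l n m hm hV, map_mul, Perm.mul_apply]

theorem bet_fix_fin (w : F) (hw : ∀ m : ℕ, 0 < m → Even m → act (Option X) m w = 1)
    (x : ℤ → Gam) (N : ℤ) (h1 : ∀ i, i < -N → x i = none) (h2 : ∀ i, N < i → x i = none) :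
    bet w x = x := by
  funext i
  by_cases hi : x i = none
  · rw [hi, (main_ind w x).1, hi]
  obtain ⟨l, ⟨hl, hli⟩, hmax⟩ := Int.exists_greatest_of_bdd (P := fun z => x z = none ∧ z < i)
    ⟨i, fun z hz => hz.2.le⟩
    ⟨min (-N - 1) (i - 1), h1 _ (by omega), by omega⟩
  obtain ⟨r, ⟨hr, hri⟩, hmin⟩ := Int.exists_least_of_bdd (P := fun z => x z = none ∧ i < z)
    ⟨i, fun z hz => hz.2.le⟩
    ⟨max (N + 1) (i + 1), h2 _ (by omega), by omega⟩
  obtain ⟨n, hn⟩ := Int.eq_ofNat_of_zero_le (a := r - l - 1) (by omega)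
  obtain ⟨k, hk⟩ := Int.eq_ofNat_of_zero_le (a := i - l - 1) (by omega)
  have hV : Valid l n x := by
    refine ⟨hl, by rw [show l + (n : ℤ) + 1 = r by omega]; exact hr, fun z hz hz' h => ?_⟩
    rcases lt_trichotomy z i with h' | h' | h'
    · have := hmax z ⟨h, h'⟩; omega
    · subst h'; exact hi h
    · have := hmin z ⟨h, h'⟩; omega
  have key := (main_ind w x).2 l n (n + n) rfl hV
  rw [hw (n + n) (by omega) ⟨n, rfl⟩, Perm.one_apply] at key
  have k1 := congrFun key ⟨k, by omega⟩
  have k2 := congrFun key ⟨n + n - 1 - k, by omega⟩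
  simp only [rd] at k1 k2
  rw [if_pos (by omega), if_pos (by omega), show l + 1 + (k : ℤ) = i by omega] at k1
  rw [if_neg (by omega), if_neg (by omega),
    show l + ((n + n : ℕ) : ℤ) - ((n + n - 1 - k : ℕ) : ℤ) = i by omega] at k2
  have hb : bet w x i ≠ none := fun h => hi (((main_ind w x).1 i).1 h)
  obtain ⟨u, hu⟩ := Option.ne_none_iff_exists'.1 hi
  obtain ⟨v, hv⟩ := Option.ne_none_iff_exists'.1 hb
  rw [hu, hv] at k1 k2 ⊢
  simp only [Option.map_some, Option.some.injEq] at k1 k2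
  rw [Prod.ext k1 k2]

theorem bet_fix (w : F) (hw : ∀ m : ℕ, 0 < m → Even m → act (Option X) m w = 1)
    (x : ℤ → Gam) : bet w x = x := by
  let u : ℕ → ℤ → Gam := fun N i => if i.natAbs ≤ N then x i else none
  have hu : Filter.Tendsto u Filter.atTop (nhds x) := by
    rw [tendsto_pi_nhds]
    intro i
    refine tendsto_const_nhds.congr' ?_
    filter_upwards [Filter.eventually_ge_atTop i.natAbs] with N hN
    simp only [u]
    rw [if_pos (by omega)]
  have h1 := ((bet_cont w).tendsto x).comp hu
  have h2 : bet w ∘ u = u := by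
    funext N
    refine bet_fix_fin w hw (u N) N (fun i hi => ?_) (fun i hi => ?_)
    · simp only [u]; rw [if_neg (by omega)]
    · simp only [u]; rw [if_neg (by omega)]
  rw [h2] at h1
  exact tendsto_nhds_unique h1 hu

/-- the belt with prescribed content -/
def wr (n : ℕ) (y : Fin (n + n) → X) (i : ℤ) : Gam :=
  if h : 0 < i ∧ i ≤ n then
    some (y ⟨(i - 1).toNat, by omega⟩, y ⟨(n + n - i).toNat, by omega⟩)
  else none

theorem rd_wr (n : ℕ) (y : Fin (n + n) → X) : rd 0 n (n + n) (wr n y) = some ∘ y := by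
  funext j
  have hj := j.2
  simp only [rd, Function.comp]
  split_ifs with h
  · rw [wr, dif_pos (by omega)]
    simp only [Option.map_some]
    congr 2
    apply Fin.ext
    simp
  · rw [wr, dif_pos (by omega)]
    simp only [Option.map_some]
    congr 2
    apply Fin.ext
    simp only
    omega

theorem wr_valid (n : ℕ) (y : Fin (n + n) → X) : Valid 0 n (wr n y) := by
  refine ⟨?_, ?_, fun i h h' => ?_⟩
  · rw [wr, dif_neg (by omega)]
  · rw [wr, dif_neg (by omega)]
  · rw [wr, dif_pos (by omega)]; simp

abbrev E : Set ℕ := {n : ℕ | 0 < n ∧ Even n}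

def genA : Option A5 → Perm (SN A5 E)
  | none => rot A5 E
  | some a => rho a

def alpha : F →* Perm (SN A5 E) := FreeGroup.lift genA

theorem range_genA : Set.range genA = insert (rot A5 E) (Set.range (rho (G := A5) (N := E))) := by
  ext p
  constructor
  · rintro ⟨_ | a, rfl⟩
    · exact Set.mem_insert _ _
    · exact Set.mem_insert_of_mem _ ⟨a, rfl⟩
  · rintro (rfl | ⟨a, rfl⟩)
    · exact ⟨none, rfl⟩
    · exact ⟨some a, rfl⟩

theorem alpha_range : alpha.range = WreathZ A5 E := by
  rw [alpha, FreeGroup.range_lift_eq_closure, WreathZ, range_genA]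

theorem genA_apply (a : Option A5) (n : E) (g : Fin (n : ℕ) → A5) :
    genA a ⟨n, g⟩ = ⟨n, gen A5 n a g⟩ := by
  cases a with
  | none => rfl
  | some a =>
    have h : (fun i : Fin (n : ℕ) =>
        (if (i : ℕ) = 0 then Equiv.mulLeft a else Equiv.refl A5) (g i)) =
        gen A5 n (some a) g := by
      funext i
      rw [gen_some]
      split_ifs <;> rfl
    rw [← h]
    rfl

theorem alpha_act (w : F) (n : E) : ∀ (g : Fin (n : ℕ) → A5),
    alpha w ⟨n, g⟩ = ⟨n, act A5 n w g⟩ := by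
  induction w using FreeGroup.induction_on with
  | C1 => intro g; simp
  | of a => intro g; simp only [alpha, act, FreeGroup.lift_apply_of, genA_apply]
  | inv_of a ih =>
    intro g
    rw [map_inv, Perm.inv_eq_iff_eq, ih, ← Perm.mul_apply, ← map_mul]
    simp
  | mul u v hu hv => intro g; rw [map_mul, Perm.mul_apply, hv, hu, map_mul, Perm.mul_apply]

theorem alpha_beta (w : F) : alpha w = 1 ↔ beta w = 1 := by
  constructor
  · intro h
    have : ∀ m : ℕ, 0 < m → Even m → act (Option X) m w = 1 := by
      intro m h0 hm
      obtain ⟨q, hq⟩ := exists_ne (1 : A5)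
      refine act_triv A5 (fun g : A5 => g) (fun a ha => by simpa using ha 1) q 1 hq (fun y => ?_) _
      have := alpha_act w ⟨m, h0, hm⟩ y
      rw [h] at this
      simp only [Perm.one_apply, Sigma.mk.injEq, heq_eq_eq, true_and] at this
      exact this.symm
    apply Subtype.ext
    ext1 x
    exact bet_fix w this x
  · intro h
    have hb : ∀ x, bet w x = x := by intro x; rw [bet, h]; rfl
    ext1 ⟨⟨m, h0, n, rfl⟩, g⟩
    rw [alpha_act, act_triv (Z := Option X) X some (fun a ha => ?_) 0 1 (by simp) (fun y => ?_) A5]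
    · rfl
    · apply Subtype.ext
      ext1 t
      have := ha t
      simp only [Option.smul_some, Option.some.injEq] at this
      exact this
    · have := (main_ind w (wr n y)).2 0 n (n + n) rfl (wr_valid n y)
      rw [hb, rd_wr] at this
      exact this.symm

end Belt

theorem stmt8 :
    ∃ (Γ : Type) (_ : Fintype Γ) (_ : TopologicalSpace Γ) (_ : DiscreteTopology Γ),
      Fintype.card Γ = 26 ∧
        ∃ φ : WreathZ A5 {n : ℕ | 0 < n ∧ Even n} →* CAut {shiftMapZ Γ},
          Function.Injective φ := by
  refine ⟨Belt.Gam, inferInstance, Belt.instTopGam, Belt.instDiscGam, by simp, ?_⟩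
  change ∃ φ : WreathZ A5 Belt.E →* CAut {shiftMapZ Belt.Gam}, Function.Injective φ
  rw [← Belt.alpha_range]
  have hker : Belt.alpha.rangeRestrict.ker ≤ Belt.beta.ker := by
    intro w hw
    rw [MonoidHom.ker_rangeRestrict] at hw
    exact (Belt.alpha_beta w).1 hw
  let φ := Belt.alpha.rangeRestrict.liftOfSurjective Belt.alpha.rangeRestrict_surjective
    ⟨Belt.beta, hker⟩
  have hφ : ∀ w, φ (Belt.alpha.rangeRestrict w) = Belt.beta w := fun w =>
    MonoidHom.liftOfRightInverse_comp_apply _ _ _ ⟨Belt.beta, hker⟩ w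
  refine ⟨φ, (injective_iff_map_eq_one φ).2 fun g hg => ?_⟩
  obtain ⟨w, rfl⟩ := Belt.alpha.rangeRestrict_surjective g
  rw [hφ] at hg
  exact Subtype.ext ((Belt.alpha_beta w).2 hg)
end

section
/- Let P = {1, 2, 3, …} be the set of all positive integers and E = {2, 4, 6, …} the set of positive even integers. Then there exists an injective group homomorphism φ : A_5 ⟅^P ℤ → A_5 ⟅^E ℤ satisfying φ(ρ_a) = ρ_a for every a ∈ A_5 and φ(↻) = ↻². -/
theorem finRotate_val_ite (n : ℕ) (i : Fin n) :
    (finRotate n i : ℕ) = if (i : ℕ) + 1 = n then 0 else (i : ℕ) + 1 := by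
  cases n with
  | zero => exact i.elim0
  | succ n =>
    rw [coe_finRotate]
    have : i = Fin.last n ↔ (i : ℕ) + 1 = n + 1 := by
      rw [Fin.ext_iff]; simp
    simp only [this]

/-- even position -/
def evp {m : ℕ} (i : Fin m) : Fin (2 * m) := ⟨2 * i, by omega⟩
/-- odd position -/
def odp {m : ℕ} (i : Fin m) : Fin (2 * m) := ⟨2 * i + 1, by omega⟩
/-- half -/
def hlf {m : ℕ} (j : Fin (2 * m)) : Fin m := ⟨j / 2, by omega⟩

/-- the action on tuples of even length -/
def twist {m : ℕ} (c : Fin m → A5) (s : Equiv.Perm (Fin m)) (y : Fin (2 * m) → A5) :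
    Fin (2 * m) → A5 :=
  fun j => if (j : ℕ) % 2 = 0 then c (hlf j) * y (evp (s (hlf j))) else y (odp (s (hlf j)))

theorem hlf_evp {m : ℕ} (i : Fin m) : hlf (evp i) = i := by
  ext; simp [hlf, evp]

theorem hlf_odp {m : ℕ} (i : Fin m) : hlf (odp i) = i := by
  ext; simp only [hlf, odp]; omega

theorem twist_evp {m : ℕ} (c : Fin m → A5) (s : Equiv.Perm (Fin m)) (y : Fin (2 * m) → A5)
    (i : Fin m) : twist c s y (evp i) = c i * y (evp (s i)) := by
  have : ((evp i : Fin (2 * m)) : ℕ) % 2 = 0 := by simp [evp]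
  simp only [twist, this, if_true, hlf_evp]

theorem twist_odp {m : ℕ} (c : Fin m → A5) (s : Equiv.Perm (Fin m)) (y : Fin (2 * m) → A5)
    (i : Fin m) : twist c s y (odp i) = y (odp (s i)) := by
  have : ¬ ((odp i : Fin (2 * m)) : ℕ) % 2 = 0 := by simp only [odp]; omega
  simp only [twist, this, if_false, hlf_odp]

theorem ext_pos {m : ℕ} {y z : Fin (2 * m) → A5} (h : ∀ i, y (evp i) = z (evp i))
    (h2 : ∀ i, y (odp i) = z (odp i)) : y = z := by
  funext j
  rcases Nat.mod_two_eq_zero_or_one j with hj | hj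
  · have : j = evp (hlf j) := by ext; simp only [evp, hlf]; omega
    rw [this]; exact h _
  · have : j = odp (hlf j) := by ext; simp only [odp, hlf]; omega
    rw [this]; exact h2 _

theorem rot2_evp {m : ℕ} (i : Fin m) :
    finRotate (2 * m) (finRotate (2 * m) (evp i)) = evp (finRotate m i) := by
  ext
  simp only [finRotate_val_ite, evp]
  split_ifs <;> omega

theorem rot2_odp {m : ℕ} (i : Fin m) :
    finRotate (2 * m) (finRotate (2 * m) (odp i)) = odp (finRotate m i) := by
  ext
  simp only [finRotate_val_ite, odp]
  split_ifs <;> omega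

abbrev PP : Set ℕ := {n : ℕ | 0 < n}
abbrev EE : Set ℕ := {n : ℕ | 0 < n ∧ Even n}

/-- map of the free group to the `P` group -/
def alphaHom : FreeGroup (Option A5) →* WreathZ A5 PP :=
  FreeGroup.lift fun o => o.elim ⟨rot A5 PP, rot_mem⟩ fun a => ⟨rho a, rho_mem a⟩

/-- map of the free group to the `E` group -/
def betaHom : FreeGroup (Option A5) →* WreathZ A5 EE :=
  FreeGroup.lift fun o => o.elim (⟨rot A5 EE, rot_mem⟩ ^ 2) fun a => ⟨rho a, rho_mem a⟩

/-- double -/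
def dbl (m : PP) : EE := ⟨2 * m, by have := m.2; change 0 < (m : ℕ) at this; exact ⟨by omega, even_two_mul _⟩⟩

/-- the compatible description of the two actions -/
def Good (m : PP) (g : Equiv.Perm (SN A5 PP)) (h : Equiv.Perm (SN A5 EE))
    (c : Fin (m : ℕ) → A5) (s : Equiv.Perm (Fin (m : ℕ))) : Prop :=
  (∀ x : Fin (m : ℕ) → A5, g ⟨m, x⟩ = ⟨m, fun i => c i * x (s i)⟩) ∧
  (∀ y : Fin (2 * (m : ℕ)) → A5, h ⟨dbl m, y⟩ = ⟨dbl m, twist c s y⟩)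

theorem good_inv {m : PP} {g h c s} (H : Good m g h c s) :
    Good m g⁻¹ h⁻¹ (fun i => (c (s⁻¹ i))⁻¹) s⁻¹ := by
  refine ⟨fun x => ?_, fun y => ?_⟩
  · rw [Equiv.Perm.inv_eq_iff_eq, H.1]
    congr 1; funext i; simp
  · rw [Equiv.Perm.inv_eq_iff_eq, H.2]
    congr 1
    refine ext_pos (fun i => ?_) (fun i => ?_)
    · simp [twist_evp]
    · simp [twist_odp]

theorem good_mul {m : PP} {g h c s g2 h2 c2 s2} (H : Good m g h c s) (H2 : Good m g2 h2 c2 s2) :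
    Good m (g * g2) (h * h2) (fun i => c i * c2 (s i)) (s2 * s) := by
  refine ⟨fun x => ?_, fun y => ?_⟩
  · rw [Equiv.Perm.mul_apply, H2.1, H.1]
    exact congrArg (Sigma.mk m) (funext fun i => by simp [mul_assoc])
  · rw [Equiv.Perm.mul_apply, H2.2, H.2]
    congr 1
    refine ext_pos (fun i => ?_) (fun i => ?_)
    · simp [twist_evp, mul_assoc]
    · simp [twist_odp]

theorem good_rot (m : PP) : Good m (rot A5 PP) (rot A5 EE ^ 2) (fun _ => 1) (finRotate m) := by
  refine ⟨fun x => ?_, fun y => ?_⟩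
  · simp only [one_mul]; rfl
  · have : (rot A5 EE ^ 2) ⟨dbl m, y⟩ =
      ⟨dbl m, fun j => y (finRotate (2 * (m : ℕ)) (finRotate (2 * (m : ℕ)) j))⟩ := rfl
    rw [this]
    congr 1
    refine ext_pos (fun i => ?_) (fun i => ?_)
    · rw [twist_evp, rot2_evp, one_mul]
    · rw [twist_odp, rot2_odp]

theorem good_rho (m : PP) (a : A5) :
    Good m (rho a) (rho a) (fun i => if (i : ℕ) = 0 then a else 1) 1 := by
  refine ⟨fun x => ?_, fun y => ?_⟩
  · have : (rho a : Equiv.Perm (SN A5 PP)) ⟨m, x⟩ = ⟨m, fun i =>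
      (if (i : ℕ) = 0 then Equiv.mulLeft a else Equiv.refl A5) (x i)⟩ := rfl
    rw [this]
    refine congrArg (Sigma.mk m) (funext fun i => ?_)
    by_cases hi : (i : ℕ) = 0 <;> simp [hi]
  · have : (rho a : Equiv.Perm (SN A5 EE)) ⟨dbl m, y⟩ = ⟨dbl m, fun i : Fin (2 * (m : ℕ)) =>
      (if (i : ℕ) = 0 then Equiv.mulLeft a else Equiv.refl A5) (y i)⟩ := rfl
    rw [this]
    congr 1
    refine ext_pos (fun i => ?_) (fun i => ?_)
    · rw [twist_evp]
      have : ((evp i : Fin (2 * (m : ℕ))) : ℕ) = 0 ↔ (i : ℕ) = 0 := by simp [evp]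
      simp only [this]
      by_cases hi : (i : ℕ) = 0 <;> simp [hi]
    · rw [twist_odp]
      have : ¬ ((odp i : Fin (2 * (m : ℕ))) : ℕ) = 0 := by simp [odp]
      simp only [this, if_false]
      simp

theorem good_word (m : PP) (w : FreeGroup (Option A5)) :
    ∃ c s, Good m (alphaHom w : Equiv.Perm (SN A5 PP)) (betaHom w : Equiv.Perm (SN A5 EE)) c s := by
  have key : ∀ o : Option A5, ∃ c s, Good m (alphaHom (FreeGroup.of o) : Equiv.Perm (SN A5 PP))
      (betaHom (FreeGroup.of o) : Equiv.Perm (SN A5 EE)) c s := by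
    intro o
    cases o with
    | none => exact ⟨_, _, by simpa [alphaHom, betaHom] using good_rot m⟩
    | some a => exact ⟨_, _, by simpa [alphaHom, betaHom] using good_rho m a⟩
  induction w using FreeGroup.induction_on with
  | C1 =>
    have := good_mul (good_rho m 1) (good_inv (good_rho m 1))
    rw [mul_inv_cancel, mul_inv_cancel] at this
    exact ⟨_, _, by simpa using this⟩
  | of o => exact key o
  | inv_of o _ =>
    obtain ⟨c, s, H⟩ := key o
    exact ⟨_, _, by simpa using good_inv H⟩
  | mul x y hx hy =>
    obtain ⟨c, s, H⟩ := hx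
    obtain ⟨c2, s2, H2⟩ := hy
    exact ⟨_, _, by simpa using good_mul H H2⟩

theorem exists_ne_one : ∃ a : A5, a ≠ 1 := by
  have : Nontrivial A5 := alternatingGroup.nontrivial_of_three_le_card (by simp)
  exact exists_ne 1

theorem trivial_of_g {n : ℕ} {c : Fin n → A5} {s : Equiv.Perm (Fin n)}
    (h : ∀ x : Fin n → A5, (fun i => c i * x (s i)) = x) : c = 1 ∧ s = 1 := by
  have hc : c = 1 := by
    funext i
    have := congrFun (h 1) i
    simpa using this
  refine ⟨hc, ?_⟩
  obtain ⟨a, ha⟩ := exists_ne_one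
  ext1 i
  have := congrFun (h (Pi.mulSingle i a)) i
  simp only [hc, Pi.one_apply, one_mul, Pi.mulSingle_eq_same] at this
  by_contra hne
  rw [Equiv.Perm.one_apply] at hne
  rw [Pi.mulSingle_eq_of_ne hne] at this
  exact ha this.symm

theorem ker_iff (w : FreeGroup (Option A5)) : alphaHom w = 1 ↔ betaHom w = 1 := by
  constructor
  · intro h
    apply Subtype.ext
    apply Equiv.ext
    rintro ⟨⟨n, hn, k, hk⟩, y⟩
    have hm : 0 < k := by change 0 < n at hn; omega
    obtain rfl : n = 2 * k := by omega
    obtain ⟨c, s, H⟩ := good_word ⟨k, hm⟩ w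
    have : c = 1 ∧ s = 1 := by
      apply trivial_of_g
      intro x
      have := H.1 x
      rw [h] at this
      exact (eq_of_heq (Sigma.mk.inj this).2).symm
    obtain ⟨rfl, rfl⟩ := this
    refine (H.2 y).trans ?_
    change (⟨_, _⟩ : SN A5 EE) = ⟨dbl ⟨k, hm⟩, y⟩
    congr 1
    refine ext_pos (fun i => ?_) (fun i => ?_)
    · simp [twist_evp]
    · simp [twist_odp]
  · intro h
    apply Subtype.ext
    apply Equiv.ext
    rintro ⟨m, x⟩
    obtain ⟨c, s, H⟩ := good_word m w
    rw [H.1 x]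
    change _ = (⟨m, x⟩ : SN A5 PP)
    congr 1
    have := H.2 (fun j => x (hlf j))
    rw [h] at this
    have := eq_of_heq (Sigma.mk.inj this).2
    funext i
    have := congrFun this (evp i)
    rw [twist_evp, hlf_evp, hlf_evp] at this
    exact this.symm

theorem alpha_surj : Function.Surjective alphaHom := by
  have hle : WreathZ A5 PP ≤ alphaHom.range.map (WreathZ A5 PP).subtype := by
    refine (Subgroup.closure_le _).2 ?_
    rintro g (rfl | ⟨a, rfl⟩)
    · exact ⟨_, ⟨FreeGroup.of none, rfl⟩, by simp [alphaHom]⟩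
    · exact ⟨_, ⟨FreeGroup.of (some a), rfl⟩, by simp [alphaHom]⟩
  rintro ⟨g, hg⟩
  obtain ⟨_, ⟨w, rfl⟩, hw⟩ := hle hg
  exact ⟨w, Subtype.ext hw⟩

theorem stmt9 :
    ∃ φ : WreathZ A5 {n : ℕ | 0 < n} →* WreathZ A5 {n : ℕ | 0 < n ∧ Even n},
      Function.Injective φ ∧
        (∀ a : A5, φ ⟨rho a, rho_mem a⟩ = ⟨rho a, rho_mem a⟩) ∧
        φ ⟨rot A5 {n : ℕ | 0 < n}, rot_mem⟩ =
          ⟨rot A5 {n : ℕ | 0 < n ∧ Even n}, rot_mem⟩ ^ 2 := by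
  let φ : WreathZ A5 PP →* WreathZ A5 EE :=
    alphaHom.liftOfSurjective alpha_surj ⟨betaHom, fun w hw => (ker_iff w).1 hw⟩
  have hφ : ∀ w, φ (alphaHom w) = betaHom w := fun w =>
    MonoidHom.liftOfRightInverse_comp_apply _ _ _ _ w
  refine ⟨φ, ?_, fun a => ?_, ?_⟩
  · rw [injective_iff_map_eq_one]
    intro g hg
    obtain ⟨w, rfl⟩ := alpha_surj g
    rw [hφ] at hg
    exact (ker_iff w).2 hg
  · have := hφ (FreeGroup.of (some a))
    simpa [alphaHom, betaHom] using this
  · have := hφ (FreeGroup.of none)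
    simpa [alphaHom, betaHom] using this
end
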